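/- arXiv:2507.21185 — 2 statements merged into one kernel-verified Lean document; each statement's English description precedes it below -/
import Mathlib

section
/- Let G be an N-function satisfying (H4), 0 < s < 1, Ω ⊂ ℝ^N a bounded domain, and 1 < q ≤ p⁻. Consider the convex cone V̇₊^q = { w : Ω → (0,∞) : w^{1/q} ∈ W^{s,G}_0(Ω) } and the functional W(w) = ∫∫_{ℝ^N×ℝ^N} G(|w(x)^{1/q} − w(y)^{1/q}| / |x−y|^s) dx dy / |x−y|^N on V̇₊^q. Then W is ray-strictly convex on V̇₊^q, i.e. W((1−t)w₁ + t w₂) ≤ (1−t)W(w₁) + t W(w₂) for all w₁, w₂ ∈ V̇₊^q and t ∈ (0,1), with strict inequality unless w₁/w₂ is a.e. equal to a positive constant. Moreover, if q ≠ p⁻, then W is strictly convex on V̇₊^q (strict inequality unless w₁ = w₂ a.e.). -/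
open MeasureTheory Filter Set
open scoped ENNReal

noncomputable section

abbrev Euc (N : ℕ) := EuclideanSpace ℝ (Fin N)

/-- An N-function: continuous, convex on `[0,∞)`, vanishing exactly at `0`,
with `G t / t → 0` as `t → 0⁺` and `G t / t → ∞` as `t → ∞`. -/
def IsNFunction (G : ℝ → ℝ) : Prop :=
  ContinuousOn G (Set.Ici 0) ∧ ConvexOn ℝ (Set.Ici 0) G ∧
  (∀ t : ℝ, 0 ≤ t → (G t = 0 ↔ t = 0)) ∧
  Tendsto (fun t => G t / t) (nhdsWithin 0 (Set.Ioi 0)) (nhds 0) ∧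
  Tendsto (fun t => G t / t) atTop atTop

/-- The fractional modular `Φ_{s,G}(u) = ∬_{ℝ^N×ℝ^N} G(|u(x)−u(y)|/|x−y|^s) dx dy/|x−y|^N`. -/
def fracModular (G : ℝ → ℝ) (s : ℝ) (N : ℕ) (u : Euc N → ℝ) : ℝ≥0∞ :=
  ∫⁻ p : Euc N × Euc N,
    ENNReal.ofReal (G (|u p.1 - u p.2| / dist p.1 p.2 ^ s) / dist p.1 p.2 ^ (N : ℝ))

/-- Membership in `W^{s,G}_0(Ω)`. -/
def MemW0 (G : ℝ → ℝ) (s : ℝ) {N : ℕ} (Ω : Set (Euc N)) (u : Euc N → ℝ) : Prop :=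
  Measurable u ∧
  (∃ l > 0, (∫⁻ x, ENNReal.ofReal (G (|u x| / l))) ≤ 1) ∧
  (∃ l > 0, fracModular G s N (fun x => u x / l) < ⊤) ∧
  (∀ x ∉ Ω, u x = 0)

/-- The convex cone `V̇₊^q`: functions positive on `Ω`, vanishing outside `Ω`,
whose `q`-th root lies in `W^{s,G}_0(Ω)`. -/
def MemVq (G : ℝ → ℝ) (s q : ℝ) {N : ℕ} (Ω : Set (Euc N)) (w : Euc N → ℝ) : Prop :=
  (∀ x ∈ Ω, 0 < w x) ∧ (∀ x ∉ Ω, w x = 0) ∧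
  MemW0 G s Ω (fun x => w x ^ (1 / q))

/-- The functional `𝒲(w) = Φ_{s,G}(w^{1/q})`. -/
def Wfun (G : ℝ → ℝ) (s q : ℝ) (N : ℕ) (w : Euc N → ℝ) : ℝ≥0∞ :=
  fracModular G s N (fun x => w x ^ (1 / q))

/-- The weighted `ℓ^q` norm of the pair `(x, y)` with weights `a` and `b`. -/
def weightedNorm (a b q x y : ℝ) : ℝ := (a * x ^ q + b * y ^ q) ^ (1 / q)

section Minkowski

variable {a b q : ℝ}

lemma weightedNorm_rpow (ha : 0 < a) (hb : 0 < b) (hq : 1 < q) {x y : ℝ} (hx : 0 ≤ x)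
    (hy : 0 ≤ y) : weightedNorm a b q x y ^ q = a * x ^ q + b * y ^ q := by
  rw [weightedNorm, one_div, Real.rpow_inv_rpow (by positivity) (by linarith)]

lemma weightedNorm_nonneg (ha : 0 < a) (hb : 0 < b) {x y : ℝ} (hx : 0 ≤ x) (hy : 0 ≤ y) :
    0 ≤ weightedNorm a b q x y := by
  unfold weightedNorm; positivity

lemma weightedNorm_mono (ha : 0 < a) (hb : 0 < b) (hq : 1 < q) {x y x' y' : ℝ} (hx : 0 ≤ x)
    (hy : 0 ≤ y) (hxx' : x ≤ x') (hyy' : y ≤ y') :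
    weightedNorm a b q x y ≤ weightedNorm a b q x' y' ∧
      (weightedNorm a b q x y = weightedNorm a b q x' y' → x = x' ∧ y = y') := by
  have hq0 : 0 < q := by linarith
  have h1 : x ^ q ≤ x' ^ q := Real.rpow_le_rpow hx hxx' hq0.le
  have h2 : y ^ q ≤ y' ^ q := Real.rpow_le_rpow hy hyy' hq0.le
  refine ⟨?_, fun h => ?_⟩
  · unfold weightedNorm
    gcongr
  · have h3 := congrArg (· ^ q) h
    simp only [weightedNorm_rpow ha hb hq hx hy,
      weightedNorm_rpow ha hb hq (hx.trans hxx') (hy.trans hyy')] at h3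
    have h4 : x ^ q = x' ^ q := by nlinarith
    have h5 : y ^ q = y' ^ q := by nlinarith
    exact ⟨(Real.rpow_left_inj hx (hx.trans hxx') hq0.ne').1 h4,
      (Real.rpow_left_inj hy (hy.trans hyy') hq0.ne').1 h5⟩

lemma eq_zero_of_weightedNorm_eq_zero (ha : 0 < a) (hb : 0 < b) (hq : 1 < q) {x y : ℝ}
    (hx : 0 ≤ x) (hy : 0 ≤ y) (h : weightedNorm a b q x y = 0) : x = 0 ∧ y = 0 := by
  have h0 : weightedNorm a b q 0 0 = 0 := by
    have : q ≠ 0 := by linarith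
    simp [weightedNorm, this]
  have := (weightedNorm_mono ha hb hq le_rfl le_rfl hx hy).2 (h0.trans h.symm)
  exact ⟨this.1.symm, this.2.symm⟩

lemma weightedNorm_add_le (ha : 0 < a) (hb : 0 < b) (hq : 1 < q) {x y u v : ℝ} (hx : 0 ≤ x)
    (hy : 0 ≤ y) (hu : 0 ≤ u) (hv : 0 ≤ v) :
    weightedNorm a b q (x + u) (y + v) ≤ weightedNorm a b q x y + weightedNorm a b q u v ∧
      (weightedNorm a b q (x + u) (y + v) = weightedNorm a b q x y + weightedNorm a b q u v →
        x * v = y * u) := by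
  have hq0 : 0 < q := by linarith
  have h0 : weightedNorm a b q 0 0 = 0 := by simp [weightedNorm, hq0.ne']
  rcases (weightedNorm_nonneg (q := q) ha hb hx hy).eq_or_lt with hA | hA
  · obtain ⟨rfl, rfl⟩ := eq_zero_of_weightedNorm_eq_zero ha hb hq hx hy hA.symm
    simp [h0]
  rcases (weightedNorm_nonneg (q := q) ha hb hu hv).eq_or_lt with hB | hB
  · obtain ⟨rfl, rfl⟩ := eq_zero_of_weightedNorm_eq_zero ha hb hq hu hv hB.symm
    simp [h0]
  have eA := weightedNorm_rpow ha hb hq hx hy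
  have eB := weightedNorm_rpow ha hb hq hu hv
  have eS := weightedNorm_rpow ha hb hq (add_nonneg hx hu) (add_nonneg hy hv)
  have hS := weightedNorm_nonneg (q := q) ha hb (add_nonneg hx hu) (add_nonneg hy hv)
  generalize weightedNorm a b q x y = A at *
  generalize weightedNorm a b q u v = B at *
  generalize weightedNorm a b q (x + u) (y + v) = S at *
  have hconv : StrictConvexOn ℝ (Ici 0) fun r : ℝ => r ^ q := strictConvexOn_rpow hq
  have hAB : 0 < A + B := by positivity
  have key : ∀ z w : ℝ, 0 ≤ z → 0 ≤ w →
      (z + w) ^ q ≤ (A + B) ^ q * (A / (A + B) * (z ^ q / A ^ q) + B / (A + B) * (w ^ q / B ^ q))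
      ∧ ((z + w) ^ q = (A + B) ^ q *
        (A / (A + B) * (z ^ q / A ^ q) + B / (A + B) * (w ^ q / B ^ q)) → z / A = w / B) := by
    intro z w hz hw
    have e : (z + w) ^ q = (A + B) ^ q *
        (A / (A + B) * (z / A) + B / (A + B) * (w / B)) ^ q := by
      rw [← Real.mul_rpow hAB.le (by positivity)]
      congr 1; field_simp
    have hsum : A / (A + B) + B / (A + B) = 1 := by field_simp
    rw [e, ← Real.div_rpow hz hA.le, ← Real.div_rpow hw hB.le]
    have hABq : 0 < (A + B) ^ q := by positivity
    refine ⟨?_, fun h => ?_⟩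
    · gcongr
      exact hconv.convexOn.2 (x := z / A) (y := w / B) (mem_Ici.2 (by positivity))
        (mem_Ici.2 (by positivity)) (by positivity) (by positivity) hsum
    · by_contra hne
      have := hconv.2 (x := z / A) (y := w / B) (mem_Ici.2 (by positivity))
        (mem_Ici.2 (by positivity)) hne (by positivity) (by positivity) hsum
      simp only [smul_eq_mul] at this
      exact this.ne (mul_left_cancel₀ hABq.ne' h)
  have k1 := key x u hx hu
  have k2 := key y v hy hv
  have total : a * ((A + B) ^ q * (A / (A + B) * (x ^ q / A ^ q) + B / (A + B) * (u ^ q / B ^ q)))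
      + b * ((A + B) ^ q * (A / (A + B) * (y ^ q / A ^ q) + B / (A + B) * (v ^ q / B ^ q)))
      = (A + B) ^ q := by
    have hAq : 0 < A ^ q := by positivity
    have hBq : 0 < B ^ q := by positivity
    have e1 : a * (x ^ q / A ^ q) + b * (y ^ q / A ^ q) = 1 := by
      rw [← mul_div_assoc, ← mul_div_assoc, ← add_div, ← eA, div_self hAq.ne']
    have e2 : a * (u ^ q / B ^ q) + b * (v ^ q / B ^ q) = 1 := by
      rw [← mul_div_assoc, ← mul_div_assoc, ← add_div, ← eB, div_self hBq.ne']
    have hsum : A / (A + B) + B / (A + B) = 1 := by field_simp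
    linear_combination (A + B) ^ q * (A / (A + B)) * e1 + (A + B) ^ q * (B / (A + B)) * e2
      + (A + B) ^ q * hsum
  have m1 := mul_le_mul_of_nonneg_left k1.1 ha.le
  have m2 := mul_le_mul_of_nonneg_left k2.1 hb.le
  refine ⟨?_, fun h => ?_⟩
  · rw [← Real.rpow_le_rpow_iff hS hAB.le hq0, eS]
    linarith
  · rw [h] at eS
    have r1 := k1.2 (mul_left_cancel₀ ha.ne' (by linarith))
    have r2 := k2.2 (mul_left_cancel₀ hb.ne' (by linarith))
    rw [div_eq_div_iff hA.ne' hB.ne'] at r1 r2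
    have : (x * v - y * u) * (A * B) = 0 := by linear_combination v * A * r1 - u * A * r2
    have := (mul_eq_zero.1 this).resolve_right (by positivity)
    linarith

/-- Reverse triangle inequality for the weighted `ℓ^q` norm on pairs, with its equality case. -/
lemma abs_weightedNorm_sub_le (ha : 0 < a) (hb : 0 < b) (hq : 1 < q) {x y u v : ℝ} (hx : 0 ≤ x)
    (hy : 0 ≤ y) (hu : 0 ≤ u) (hv : 0 ≤ v) :
    |weightedNorm a b q x y - weightedNorm a b q u v| ≤ weightedNorm a b q |x - u| |y - v| ∧
      (|weightedNorm a b q x y - weightedNorm a b q u v| = weightedNorm a b q |x - u| |y - v| →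
        x * v = y * u) := by
  wlog h : weightedNorm a b q u v ≤ weightedNorm a b q x y generalizing x y u v
  · have := this hu hv hx hy (le_of_not_ge h)
    rw [abs_sub_comm (weightedNorm a b q x y), abs_sub_comm x, abs_sub_comm y]
    exact ⟨this.1, fun h' => by linarith [this.2 h', mul_comm x v, mul_comm y u]⟩
  rw [abs_of_nonneg (sub_nonneg.2 h)]
  have hxu : x ≤ u + |x - u| := by linarith [le_abs_self (x - u)]
  have hyv : y ≤ v + |y - v| := by linarith [le_abs_self (y - v)]
  have h1 := weightedNorm_mono ha hb hq hx hy hxu hyv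
  have h2 := weightedNorm_add_le ha hb hq hu hv (abs_nonneg (x - u)) (abs_nonneg (y - v))
  refine ⟨by linarith [h1.1, h2.1], fun h' => ?_⟩
  obtain ⟨e1, e2⟩ := h1.2 (by linarith [h1.1, h2.1])
  have e3 := h2.2 (by linarith [h1.1, h2.1])
  linear_combination v * e1 - u * e2 - e3

end Minkowski

section Orlicz

variable {G g g' : ℝ → ℝ} {p q : ℝ}

lemma strictMonoOn_of_hasDerivAt_pos (hc : ContinuousOn G (Ici 0))
    (hGg : ∀ t : ℝ, 0 < t → HasDerivAt G (g t) t) (hg : ∀ t : ℝ, 0 < t → 0 < g t) :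
    StrictMonoOn G (Ici 0) := by
  refine strictMonoOn_of_deriv_pos (convex_Ici 0) hc fun x hx => ?_
  rw [interior_Ici] at hx
  rw [(hGg x hx).deriv]
  exact hg x hx

lemma hasDerivAt_mul_rpow (hgg' : ∀ t : ℝ, 0 < t → HasDerivAt g (g' t) t)
    {t : ℝ} (ht : 0 < t) :
    HasDerivAt (fun r => g r * r ^ (1 - q)) (t ^ (-q) * (t * g' t - (q - 1) * g t)) t := by
  have h := (hgg' t ht).mul (Real.hasDerivAt_rpow_const (p := 1 - q) (Or.inl ht.ne'))
  refine h.congr_deriv ?_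
  rw [show (1 - q) = 1 + (-q) by ring, Real.rpow_add ht, Real.rpow_one,
    show 1 + -q - 1 = -q by ring]
  ring

lemma continuousOn_mul_rpow (hgg' : ∀ t : ℝ, 0 < t → HasDerivAt g (g' t) t) :
    ContinuousOn (fun r => g r * r ^ (1 - q)) (Ioi 0) := fun _ ht =>
  (hasDerivAt_mul_rpow hgg' ht).continuousAt.continuousWithinAt

lemma hasDerivAt_comp_rpow (hGg : ∀ t : ℝ, 0 < t → HasDerivAt G (g t) t) {r : ℝ}
    (hr : 0 < r) (hq : 0 < q) :
    HasDerivAt (fun r => G (r ^ (1 / q)))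
      (1 / q * (g (r ^ (1 / q)) * (r ^ (1 / q)) ^ (1 - q))) r := by
  have h := (hGg (r ^ (1 / q)) (by positivity)).comp r
    (Real.hasDerivAt_rpow_const (p := 1 / q) (Or.inl hr.ne'))
  refine h.congr_deriv ?_
  rw [← Real.rpow_mul hr.le, show 1 / q * (1 - q) = 1 / q - 1 by field_simp]
  ring

lemma continuousOn_comp_rpow (hc : ContinuousOn G (Ici 0)) (hq : 0 < q) :
    ContinuousOn (fun r => G (r ^ (1 / q))) (Ici 0) :=
  hc.comp (Real.continuous_rpow_const (by positivity)).continuousOn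
    fun r hr => Real.rpow_nonneg hr _

/-- If `t g'(t) ≥ (q - 1) g(t)`, then `r ↦ G (r ^ (1 / q))` is convex. -/
lemma convexOn_comp_rpow (hc : ContinuousOn G (Ici 0))
    (hGg : ∀ t : ℝ, 0 < t → HasDerivAt G (g t) t)
    (hgg' : ∀ t : ℝ, 0 < t → HasDerivAt g (g' t) t) (hq : 0 < q)
    (h : ∀ t : ℝ, 0 < t → (q - 1) * g t ≤ t * g' t) :
    ConvexOn ℝ (Ici 0) fun r => G (r ^ (1 / q)) := by
  have hm : MonotoneOn (fun r => g r * r ^ (1 - q)) (Ioi 0) := by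
    refine monotoneOn_of_deriv_nonneg (convex_Ioi 0) (continuousOn_mul_rpow hgg')
      (fun t ht => ?_) fun t ht => ?_ <;> rw [interior_Ioi] at ht
    · exact (hasDerivAt_mul_rpow hgg' ht).differentiableAt.differentiableWithinAt
    · rw [(hasDerivAt_mul_rpow hgg' ht).deriv]
      exact mul_nonneg (Real.rpow_nonneg (le_of_lt ht) _) (sub_nonneg.2 (h t ht))
  refine MonotoneOn.convexOn_of_deriv (convex_Ici 0) (continuousOn_comp_rpow hc hq)
    (fun r hr => ?_) fun x hx y hy hxy => ?_
  · rw [interior_Ici] at hr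
    exact (hasDerivAt_comp_rpow hGg hr hq).differentiableAt.differentiableWithinAt
  · rw [interior_Ici] at hx hy
    rw [(hasDerivAt_comp_rpow hGg hx hq).deriv, (hasDerivAt_comp_rpow hGg hy hq).deriv]
    exact mul_le_mul_of_nonneg_left (hm (Real.rpow_pos_of_pos hx _) (Real.rpow_pos_of_pos hy _)
      (Real.rpow_le_rpow (le_of_lt hx) hxy (by positivity))) (by positivity)

/-- If `t g'(t) > (q - 1) g(t)`, then `r ↦ G (r ^ (1 / q))` is strictly convex. -/
lemma strictConvexOn_comp_rpow (hc : ContinuousOn G (Ici 0))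
    (hGg : ∀ t : ℝ, 0 < t → HasDerivAt G (g t) t)
    (hgg' : ∀ t : ℝ, 0 < t → HasDerivAt g (g' t) t) (hq : 0 < q)
    (h : ∀ t : ℝ, 0 < t → (q - 1) * g t < t * g' t) :
    StrictConvexOn ℝ (Ici 0) fun r => G (r ^ (1 / q)) := by
  have hm : StrictMonoOn (fun r => g r * r ^ (1 - q)) (Ioi 0) := by
    refine strictMonoOn_of_deriv_pos (convex_Ioi 0) (continuousOn_mul_rpow hgg')
      fun t ht => ?_
    rw [interior_Ioi] at ht
    rw [(hasDerivAt_mul_rpow hgg' ht).deriv]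
    exact mul_pos (Real.rpow_pos_of_pos ht _) (sub_pos.2 (h t ht))
  refine StrictMonoOn.strictConvexOn_of_deriv (convex_Ici 0) (continuousOn_comp_rpow hc hq)
    fun x hx y hy hxy => ?_
  rw [interior_Ici] at hx hy
  rw [(hasDerivAt_comp_rpow hGg hx hq).deriv, (hasDerivAt_comp_rpow hGg hy hq).deriv]
  exact mul_lt_mul_of_pos_left (hm (Real.rpow_pos_of_pos hx _) (Real.rpow_pos_of_pos hy _)
    (Real.rpow_lt_rpow (le_of_lt hx) hxy (by positivity))) (by positivity)

/-- The `Δ₂` condition: if `t g'(t) ≤ (p - 1) g(t)`, then `G (l t) ≤ l ^ p G t` for `l ≥ 1`. -/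
lemma apply_mul_le_rpow_mul (hc : ContinuousOn G (Ici 0)) (hG0 : G 0 = 0)
    (hGg : ∀ t : ℝ, 0 < t → HasDerivAt G (g t) t)
    (hgg' : ∀ t : ℝ, 0 < t → HasDerivAt g (g' t) t)
    (h : ∀ t : ℝ, 0 < t → t * g' t ≤ (p - 1) * g t) {l t : ℝ} (hl : 1 ≤ l) (ht : 0 ≤ t) :
    G (l * t) ≤ l ^ p * G t := by
  have hl0 : 0 < l := by linarith
  have hm : AntitoneOn (fun r => g r * r ^ (1 - p)) (Ioi 0) := by
    refine antitoneOn_of_deriv_nonpos (convex_Ioi 0) (continuousOn_mul_rpow hgg')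
      (fun t ht => ?_) fun t ht => ?_ <;> rw [interior_Ioi] at ht
    · exact (hasDerivAt_mul_rpow hgg' ht).differentiableAt.differentiableWithinAt
    · rw [(hasDerivAt_mul_rpow hgg' ht).deriv]
      exact mul_nonpos_of_nonneg_of_nonpos (Real.rpow_nonneg (le_of_lt ht) _)
        (sub_nonpos.2 (h t ht))
  have hd : ∀ r : ℝ, 0 < r →
      HasDerivAt (fun r => l ^ p * G r - G (l * r)) (l ^ p * g r - l * g (l * r)) r := by
    intro r hr
    have h1 := (hGg (l * r) (by positivity)).comp r ((hasDerivAt_id r).const_mul l)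
    refine (((hGg r hr).const_mul (l ^ p)).sub h1).congr_deriv ?_
    ring
  have hmono : MonotoneOn (fun r => l ^ p * G r - G (l * r)) (Ici 0) := by
    refine monotoneOn_of_deriv_nonneg (convex_Ici 0) ?_ (fun r hr => ?_) fun r hr => ?_
    · refine (continuousOn_const.mul hc).sub (hc.comp (by fun_prop) fun r hr => ?_)
      exact mul_nonneg hl0.le hr
    · rw [interior_Ici] at hr
      exact (hd r hr).differentiableAt.differentiableWithinAt
    · rw [interior_Ici] at hr
      have hr' : 0 < r := hr
      rw [(hd r hr).deriv, sub_nonneg]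
      have := hm hr (mul_pos hl0 hr : l * r ∈ Ioi 0) (by nlinarith)
      simp only at this
      rw [Real.mul_rpow hl0.le hr'.le, ← mul_assoc] at this
      have h2 := le_of_mul_le_mul_right this (by positivity)
      calc l * g (l * r) = l ^ p * (g (l * r) * l ^ (1 - p)) := by
            rw [mul_left_comm, ← Real.rpow_add hl0]; simp [mul_comm]
        _ ≤ l ^ p * g r := by gcongr
  have := hmono (self_mem_Ici : (0 : ℝ) ∈ Ici 0) ht ht
  simp only [mul_zero, hG0, sub_zero] at this
  linarith

lemma IsNFunction.nonneg (hG : IsNFunction G) {t : ℝ} (ht : 0 ≤ t) : 0 ≤ G t := by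
  obtain ⟨-, hconv, h0, hlim, -⟩ := hG
  rcases ht.eq_or_lt with rfl | ht
  · exact ((h0 0 le_rfl).2 rfl).ge
  suffices h : 0 ≤ G t / t by
    have := mul_nonneg h ht.le
    rwa [div_mul_cancel₀ _ ht.ne'] at this
  refine le_of_tendsto hlim ?_
  filter_upwards [Ioo_mem_nhdsGT ht] with r hr
  have hc := hconv.2 (mem_Ici.2 ht.le) (mem_Ici.2 le_rfl) (div_nonneg hr.1.le ht.le)
    (sub_nonneg.2 ((div_le_one ht).2 hr.2.le)) (add_sub_cancel (r / t) 1)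
  simp only [smul_eq_mul, mul_zero, add_zero, (h0 0 le_rfl).2 rfl,
    div_mul_cancel₀ _ ht.ne'] at hc
  rw [div_le_iff₀ hr.1]
  linarith [show G t / t * r = r / t * G t by ring]

lemma IsNFunction.deriv_nonneg (hG : IsNFunction G)
    (hGg : ∀ t : ℝ, 0 < t → HasDerivAt G (g t) t) {t : ℝ} (ht : 0 < t) : 0 ≤ g t := by
  have h := hG.2.1.slope_le_of_hasDerivAt (x := 0) (y := t) self_mem_Ici ht.le ht (hGg t ht)
  refine le_trans ?_ h
  rw [slope_def_field, (hG.2.2.1 0 le_rfl).2 rfl]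
  simpa using div_nonneg (hG.nonneg ht.le) ht.le

/-- Pointwise convexity of the integrand of `Wfun`, with its equality cases. -/
lemma apply_abs_rpow_sub_le (hmono : StrictMonoOn G (Ici 0))
    (hconv : ConvexOn ℝ (Ici 0) fun r => G (r ^ (1 / q))) (hq : 1 < q)
    {a b k x₁ x₂ y₁ y₂ : ℝ} (ha : 0 < a) (hb : 0 < b) (hab : a + b = 1) (hk : 0 < k)
    (hx₁ : 0 ≤ x₁) (hx₂ : 0 ≤ x₂) (hy₁ : 0 ≤ y₁) (hy₂ : 0 ≤ y₂) :
    G (|(a * x₁ + b * x₂) ^ (1 / q) - (a * y₁ + b * y₂) ^ (1 / q)| / k) ≤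
        a * G (|x₁ ^ (1 / q) - y₁ ^ (1 / q)| / k) + b * G (|x₂ ^ (1 / q) - y₂ ^ (1 / q)| / k) ∧
      (G (|(a * x₁ + b * x₂) ^ (1 / q) - (a * y₁ + b * y₂) ^ (1 / q)| / k) =
        a * G (|x₁ ^ (1 / q) - y₁ ^ (1 / q)| / k) + b * G (|x₂ ^ (1 / q) - y₂ ^ (1 / q)| / k) →
        x₁ * y₂ = x₂ * y₁ ∧
        (StrictConvexOn ℝ (Ici 0) (fun r => G (r ^ (1 / q))) →
          |x₁ ^ (1 / q) - y₁ ^ (1 / q)| = |x₂ ^ (1 / q) - y₂ ^ (1 / q)|)) := by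
  have hq0 : 0 < q := by linarith
  have root : ∀ z : ℝ, 0 ≤ z → (z ^ (1 / q)) ^ q = z := fun z hz => by
    rw [one_div, Real.rpow_inv_rpow hz hq0.ne']
  have root' : ∀ z : ℝ, 0 ≤ z → (z ^ q) ^ (1 / q) = z := fun z hz => by
    rw [one_div, Real.rpow_rpow_inv hz hq0.ne']
  have key := abs_weightedNorm_sub_le ha hb hq (Real.rpow_nonneg hx₁ (1 / q))
    (Real.rpow_nonneg hx₂ (1 / q)) (Real.rpow_nonneg hy₁ (1 / q)) (Real.rpow_nonneg hy₂ (1 / q))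
  have ex : weightedNorm a b q (x₁ ^ (1 / q)) (x₂ ^ (1 / q)) = (a * x₁ + b * x₂) ^ (1 / q) := by
    rw [weightedNorm, root _ hx₁, root _ hx₂]
  have ey : weightedNorm a b q (y₁ ^ (1 / q)) (y₂ ^ (1 / q)) = (a * y₁ + b * y₂) ^ (1 / q) := by
    rw [weightedNorm, root _ hy₁, root _ hy₂]
  rw [ex, ey] at key
  set δ₁ := |x₁ ^ (1 / q) - y₁ ^ (1 / q)| with hδ₁
  set δ₂ := |x₂ ^ (1 / q) - y₂ ^ (1 / q)| with hδ₂
  set D := |(a * x₁ + b * x₂) ^ (1 / q) - (a * y₁ + b * y₂) ^ (1 / q)|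
  have hd₁ : 0 ≤ δ₁ := abs_nonneg _
  have hd₂ : 0 ≤ δ₂ := abs_nonneg _
  have hM := weightedNorm_nonneg (q := q) ha hb hd₁ hd₂
  have eM : weightedNorm a b q δ₁ δ₂ / k
      = (a * (δ₁ / k) ^ q + b * (δ₂ / k) ^ q) ^ (1 / q) := by
    rw [Real.div_rpow hd₁ hk.le, Real.div_rpow hd₂ hk.le, ← mul_div_assoc, ← mul_div_assoc,
      ← add_div, Real.div_rpow (by positivity) (by positivity), root' k hk.le, weightedNorm]
  have r₁ : (δ₁ / k) ^ q ∈ Ici (0 : ℝ) := mem_Ici.2 (by positivity)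
  have r₂ : (δ₂ / k) ^ q ∈ Ici (0 : ℝ) := mem_Ici.2 (by positivity)
  have hD : D / k ∈ Ici (0 : ℝ) := mem_Ici.2 (div_nonneg (abs_nonneg _) hk.le)
  have hMk : weightedNorm a b q δ₁ δ₂ / k ∈ Ici (0 : ℝ) := mem_Ici.2 (div_nonneg hM hk.le)
  have step1 : G (D / k) ≤ G (weightedNorm a b q δ₁ δ₂ / k) :=
    hmono.monotoneOn hD hMk (div_le_div_of_nonneg_right key.1 hk.le)
  have step2 := hconv.2 r₁ r₂ ha.le hb.le hab
  simp only [smul_eq_mul] at step2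
  rw [← eM, root' _ (by positivity), root' _ (by positivity)] at step2
  refine ⟨step1.trans step2, fun h => ⟨?_, fun hs => ?_⟩⟩
  · have e := hmono.injOn hD hMk (le_antisymm step1 (by linarith))
    have e2 := key.2 ((div_left_inj' hk.ne').1 e)
    have e3 := congrArg (· ^ q) e2
    simpa only [Real.mul_rpow (Real.rpow_nonneg hx₁ (1 / q)) (Real.rpow_nonneg hy₂ (1 / q)),
      Real.mul_rpow (Real.rpow_nonneg hx₂ (1 / q)) (Real.rpow_nonneg hy₁ (1 / q)),
      root _ hx₁, root _ hx₂, root _ hy₁, root _ hy₂] using e3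
  · by_contra hne
    have hne' : (δ₁ / k) ^ q ≠ (δ₂ / k) ^ q := fun h' => hne <| by
      rwa [Real.rpow_left_inj (by positivity) (by positivity) hq0.ne',
        div_left_inj' hk.ne'] at h'
    have := hs.2 r₁ r₂ hne' ha hb hab
    simp only [smul_eq_mul] at this
    rw [← eM, root' _ (by positivity), root' _ (by positivity)] at this
    linarith

end Orlicz

section Modular

variable {G : ℝ → ℝ} {s q : ℝ} {N : ℕ} {Ω : Set (Euc N)}

/-- The integrand of `fracModular`. -/
def modularKernel (G : ℝ → ℝ) (s : ℝ) {N : ℕ} (u : Euc N → ℝ) (p : Euc N × Euc N) : ℝ :=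
  G (|u p.1 - u p.2| / dist p.1 p.2 ^ s) / dist p.1 p.2 ^ (N : ℝ)

lemma modularKernel_nonneg (hG : IsNFunction G) (u : Euc N → ℝ) (p : Euc N × Euc N) :
    0 ≤ modularKernel G s u p :=
  div_nonneg (hG.nonneg (by positivity)) (by positivity)

lemma measurable_modularKernel (hc : ContinuousOn G (Ici 0)) {u : Euc N → ℝ}
    (hu : Measurable u) : Measurable (modularKernel G s u) := by
  have hGm : Measurable fun r => G (max 0 r) :=
    (hc.comp_continuous (by fun_prop) fun r => mem_Ici.2 (le_max_left _ _)).measurable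
  have he : modularKernel G s u = fun p : Euc N × Euc N =>
      G (max 0 (|u p.1 - u p.2| / dist p.1 p.2 ^ s)) / dist p.1 p.2 ^ (N : ℝ) := by
    funext p
    rw [max_eq_right (by positivity), modularKernel]
  rw [he]
  have hd : Measurable fun p : Euc N × Euc N => dist p.1 p.2 := measurable_dist
  have h1 : Measurable fun p : Euc N × Euc N => |u p.1 - u p.2| :=
    continuous_abs.measurable.comp
      ((hu.comp measurable_fst).sub (hu.comp measurable_snd))
  exact (hGm.comp (h1.div (hd.pow_const s))).div (hd.pow_const (N : ℝ))

lemma fracModular_lt_top_of_div {p : ℝ}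
    (hΔ : ∀ l t : ℝ, 1 ≤ l → 0 ≤ t → G (l * t) ≤ l ^ p * G t)
    (hmono : MonotoneOn G (Ici 0)) {u : Euc N → ℝ} {l : ℝ} (hl : 0 < l)
    (h : fracModular G s N (fun x => u x / l) < ⊤) : fracModular G s N u < ⊤ := by
  set m := max 1 l
  have hm : 1 ≤ m := le_max_left _ _
  refine lt_of_le_of_lt ?_ (ENNReal.mul_lt_top (ENNReal.ofReal_lt_top (r := m ^ p)) h)
  rw [fracModular, fracModular, ← lintegral_const_mul' _ _ ENNReal.ofReal_ne_top]
  refine lintegral_mono fun z => ?_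
  rw [← ENNReal.ofReal_mul (by positivity), ← mul_div_assoc]
  refine ENNReal.ofReal_le_ofReal (div_le_div_of_nonneg_right ?_ (by positivity))
  refine le_trans (hmono (mem_Ici.2 (by positivity)) (mem_Ici.2 (by positivity)) ?_)
    (hΔ m _ hm (by positivity))
  rw [← mul_div_assoc]
  refine div_le_div_of_nonneg_right ?_ (by positivity)
  rw [← sub_div, abs_div, abs_of_pos hl, ← mul_div_assoc, le_div_iff₀ hl, mul_comm]
  exact mul_le_mul_of_nonneg_right (le_max_right _ _) (abs_nonneg _)

lemma MemVq.nonneg {w : Euc N → ℝ} (hw : MemVq G s q Ω w) (x : Euc N) : 0 ≤ w x := by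
  by_cases hx : x ∈ Ω
  · exact (hw.1 x hx).le
  · exact (hw.2.1 x hx).ge

lemma MemVq.measurable {w : Euc N → ℝ} (hw : MemVq G s q Ω w) (hq : 0 < q) :
    Measurable w := by
  have h : w = fun x => (w x ^ (1 / q)) ^ q := by
    funext x
    rw [one_div, Real.rpow_inv_rpow (hw.nonneg x) hq.ne']
  rw [h]
  exact hw.2.2.1.pow_const q

end Modular

/-- for an N-function `G` satisfying (H4) and `1 < q ≤ p⁻`, the functional
`𝒲(w) = ∬ G(|w(x)^{1/q} − w(y)^{1/q}|/|x−y|^s) dx dy/|x−y|^N` is ray-strictly convex on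
the cone `V̇₊^q`: `𝒲((1−t)w₁ + t w₂) ≤ (1−t)𝒲(w₁) + t 𝒲(w₂)`, with equality forcing
`w₁/w₂` to be a.e. a positive constant; and if `q ≠ p⁻`, equality forces `w₁ = w₂` a.e. -/
theorem Wfun_ray_strictly_convex
    {N : ℕ} (hN : 0 < N)
    (G g g' : ℝ → ℝ) (pm pp : ℝ) (hG : IsNFunction G)
    (hGg : ∀ t : ℝ, 0 < t → HasDerivAt G (g t) t)
    (hgg' : ∀ t : ℝ, 0 < t → HasDerivAt g (g' t) t)
    (hg'cont : ContinuousOn g' (Set.Ioi 0))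
    (hpm : 1 < pm - 1) (hpmpp : pm ≤ pp)
    (hH4 : ∀ t : ℝ, 0 < t → pm - 1 ≤ t * g' t / g t ∧ t * g' t / g t ≤ pp - 1)
    (s : ℝ) (hs0 : 0 < s) (hs1 : s < 1)
    (Ω : Set (Euc N)) (hΩopen : IsOpen Ω) (hΩbd : Bornology.IsBounded Ω)
    (hΩconn : IsConnected Ω)
    (q : ℝ) (hq1 : 1 < q) (hqpm : q ≤ pm)
    (w₁ w₂ : Euc N → ℝ) (hw₁ : MemVq G s q Ω w₁) (hw₂ : MemVq G s q Ω w₂)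
    (t : ℝ) (ht : t ∈ Set.Ioo (0:ℝ) 1) :
    Wfun G s q N (fun x => (1 - t) * w₁ x + t * w₂ x)
        ≤ ENNReal.ofReal (1 - t) * Wfun G s q N w₁ + ENNReal.ofReal t * Wfun G s q N w₂ ∧
    (Wfun G s q N (fun x => (1 - t) * w₁ x + t * w₂ x)
        = ENNReal.ofReal (1 - t) * Wfun G s q N w₁ + ENNReal.ofReal t * Wfun G s q N w₂ →
      (∃ c : ℝ, 0 < c ∧ ∀ᵐ x ∂(volume.restrict Ω), w₁ x = c * w₂ x) ∧
      (q ≠ pm → ∀ᵐ x ∂(volume.restrict Ω), w₁ x = w₂ x)) := by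
  obtain ⟨ht0, ht1⟩ := ht
  have hta : 0 < 1 - t := sub_pos.2 ht1
  have hq0 : 0 < q := by linarith
  have hc := hG.1
  have hG0 : G 0 = 0 := (hG.2.2.1 0 le_rfl).2 rfl
  have hgpos : ∀ r : ℝ, 0 < r → 0 < g r := fun r hr => by
    refine (hG.deriv_nonneg hGg hr).lt_of_ne fun h => ?_
    have := (hH4 r hr).1
    rw [← h, div_zero] at this
    linarith
  have hlow : ∀ r : ℝ, 0 < r → (pm - 1) * g r ≤ r * g' r := fun r hr =>
    (le_div_iff₀ (hgpos r hr)).1 (hH4 r hr).1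
  have hup : ∀ r : ℝ, 0 < r → r * g' r ≤ (pp - 1) * g r := fun r hr =>
    (div_le_iff₀ (hgpos r hr)).1 (hH4 r hr).2
  have hmono := strictMonoOn_of_hasDerivAt_pos hc hGg hgpos
  have hconv := convexOn_comp_rpow hc hGg hgg' hq0 fun r hr =>
    le_trans (mul_le_mul_of_nonneg_right (by linarith) (hgpos r hr).le) (hlow r hr)
  have hfin : ∀ w, MemVq G s q Ω w → Wfun G s q N w < ⊤ := by
    rintro w ⟨-, -, -, -, ⟨l, hl, h⟩, -⟩
    exact fracModular_lt_top_of_div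
      (fun _ _ h1 h2 => apply_mul_le_rpow_mul hc hG0 hGg hgg' hup h1 h2) hmono.monotoneOn hl h
  set w : Euc N → ℝ := fun x => (1 - t) * w₁ x + t * w₂ x
  let κ (v : Euc N → ℝ) : Euc N × Euc N → ℝ := modularKernel G s fun x => v x ^ (1 / q)
  have hκ0 : ∀ v p, 0 ≤ κ v p := fun v p => modularKernel_nonneg hG _ p
  have hm₁ : Measurable fun p => ENNReal.ofReal (κ w₁ p) :=
    (measurable_modularKernel hc hw₁.2.2.1).ennreal_ofReal
  have hm₂ : Measurable fun p => ENNReal.ofReal (κ w₂ p) :=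
    (measurable_modularKernel hc hw₂.2.2.1).ennreal_ofReal
  have hrhs : ENNReal.ofReal (1 - t) * Wfun G s q N w₁ + ENNReal.ofReal t * Wfun G s q N w₂ =
      ∫⁻ p, ENNReal.ofReal ((1 - t) * κ w₁ p + t * κ w₂ p) := by
    calc _ = ENNReal.ofReal (1 - t) * (∫⁻ p, ENNReal.ofReal (κ w₁ p)) +
          ENNReal.ofReal t * ∫⁻ p, ENNReal.ofReal (κ w₂ p) := rfl
      _ = _ := by
        rw [← lintegral_const_mul _ hm₁, ← lintegral_const_mul _ hm₂,
          ← lintegral_add_left (hm₁.const_mul _)]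
        refine lintegral_congr fun p => ?_
        rw [ENNReal.ofReal_add (mul_nonneg hta.le (hκ0 _ _)) (mul_nonneg ht0.le (hκ0 _ _)),
          ENNReal.ofReal_mul hta.le, ENNReal.ofReal_mul ht0.le]
  have hpt : ∀ x y : Euc N, x ≠ y → _ := fun x y hxy =>
    apply_abs_rpow_sub_le hmono hconv hq1 hta ht0 (sub_add_cancel 1 t)
      (Real.rpow_pos_of_pos (dist_pos.2 hxy) s) (hw₁.nonneg x) (hw₂.nonneg x) (hw₁.nonneg y)
      (hw₂.nonneg y)
  have hsplit : ∀ x y : Euc N, (1 - t) * κ w₁ (x, y) + t * κ w₂ (x, y) =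
      ((1 - t) * G (|w₁ x ^ (1 / q) - w₁ y ^ (1 / q)| / dist x y ^ s) +
        t * G (|w₂ x ^ (1 / q) - w₂ y ^ (1 / q)| / dist x y ^ s)) / dist x y ^ (N : ℝ) :=
    fun x y => by simp only [κ, modularKernel]; ring
  have hle : ∀ p, κ w p ≤ (1 - t) * κ w₁ p + t * κ w₂ p := by
    rintro ⟨x, y⟩
    rcases eq_or_ne x y with rfl | hxy
    · simp [κ, modularKernel, hG0]
    · rw [hsplit]
      exact div_le_div_of_nonneg_right (hpt x y hxy).1 (by positivity)
  have hle' : ∀ p, ENNReal.ofReal (κ w p) ≤ ENNReal.ofReal ((1 - t) * κ w₁ p + t * κ w₂ p) :=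
    fun p => ENNReal.ofReal_le_ofReal (hle p)
  rw [hrhs]
  refine ⟨lintegral_mono hle', fun heq => ?_⟩
  have hne : ∫⁻ p, ENNReal.ofReal (κ w p) ≠ ⊤ := by
    refine ne_of_lt (lt_of_le_of_lt (lintegral_mono hle') ?_)
    rw [← hrhs]
    exact ENNReal.add_lt_top.2 ⟨ENNReal.mul_lt_top ENNReal.ofReal_lt_top (hfin _ hw₁),
      ENNReal.mul_lt_top ENNReal.ofReal_lt_top (hfin _ hw₂)⟩
  have hmr : Measurable fun p => ENNReal.ofReal ((1 - t) * κ w₁ p + t * κ w₂ p) :=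
    (((measurable_modularKernel hc hw₁.2.2.1).const_mul _).add
      ((measurable_modularKernel hc hw₂.2.2.1).const_mul _)).ennreal_ofReal
  have hae := ae_eq_of_ae_le_of_lintegral_le (Eventually.of_forall hle') hne hmr.aemeasurable
    heq.ge
  have hae2 : ∀ᵐ p : Euc N × Euc N, w₁ p.1 * w₂ p.2 = w₂ p.1 * w₁ p.2 ∧
      (StrictConvexOn ℝ (Ici 0) (fun r => G (r ^ (1 / q))) →
        |w₁ p.1 ^ (1 / q) - w₁ p.2 ^ (1 / q)| = |w₂ p.1 ^ (1 / q) - w₂ p.2 ^ (1 / q)|) := by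
    filter_upwards [hae] with p hp
    obtain ⟨x, y⟩ := p
    rcases eq_or_ne x y with rfl | hxy
    · simp [mul_comm]
    · have h1 : κ w (x, y) = (1 - t) * κ w₁ (x, y) + t * κ w₂ (x, y) :=
        (ENNReal.ofReal_eq_ofReal_iff (hκ0 _ _) ((hκ0 w _).trans (hle _))).1 hp
      rw [hsplit] at h1
      have hdN : dist x y ^ (N : ℝ) ≠ 0 := (Real.rpow_pos_of_pos (dist_pos.2 hxy) _).ne'
      exact (hpt x y hxy).2 ((div_left_inj' hdN).1 h1)
  have hae3 : ∀ᵐ y : Euc N, ∀ᵐ x : Euc N, w₁ y * w₂ x = w₂ y * w₁ x ∧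
      (StrictConvexOn ℝ (Ici 0) (fun r => G (r ^ (1 / q))) →
        |w₁ y ^ (1 / q) - w₁ x ^ (1 / q)| = |w₂ y ^ (1 / q) - w₂ x ^ (1 / q)|) :=
    Measure.ae_ae_of_ae_prod hae2
  have hΩ0 : (volume : Measure (Euc N)) Ω ≠ 0 :=
    (hΩopen.measure_pos volume hΩconn.nonempty).ne'
  refine ⟨?_, fun hqne => ?_⟩
  · obtain ⟨y, hy, h⟩ := Measure.exists_mem_of_measure_ne_zero_of_ae hΩ0 (ae_restrict_of_ae hae3)
    refine ⟨w₁ y / w₂ y, div_pos (hw₁.1 y hy) (hw₂.1 y hy), ae_restrict_of_ae ?_⟩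
    filter_upwards [h] with x hx
    have := (hw₂.1 y hy).ne'
    field_simp
    linarith [hx.1]
  · have hqlt : q < pm := hqpm.lt_of_ne hqne
    have hstrict := strictConvexOn_comp_rpow hc hGg hgg' hq0 fun r hr =>
      lt_of_lt_of_le (mul_lt_mul_of_pos_right (by linarith) (hgpos r hr)) (hlow r hr)
    have : Nonempty (Fin N) := ⟨⟨0, hN⟩⟩
    have hΩc : (volume : Measure (Euc N)) Ωᶜ ≠ 0 := by
      rw [measure_compl hΩopen.measurableSet hΩbd.measure_lt_top.ne,
        measure_univ_of_isAddLeftInvariant]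
      simp [ENNReal.top_sub, hΩbd.measure_lt_top.ne]
    obtain ⟨y, hy, h⟩ := Measure.exists_mem_of_measure_ne_zero_of_ae hΩc (ae_restrict_of_ae hae3)
    refine ae_restrict_of_ae ?_
    filter_upwards [h] with x hx
    have e := hx.2 hstrict
    rw [hw₁.2.1 y hy, hw₂.2.1 y hy, Real.zero_rpow (by positivity), zero_sub, zero_sub, abs_neg,
      abs_neg, abs_of_nonneg (Real.rpow_nonneg (hw₁.nonneg x) _),
      abs_of_nonneg (Real.rpow_nonneg (hw₂.nonneg x) _)] at e
    exact (Real.rpow_left_inj (hw₁.nonneg x) (hw₂.nonneg x) (by positivity)).1 e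
end
end

section
/- Let Ω ⊂ ℝ^N be a smooth bounded domain, 0 < s < 1, and let G be an N-function satisfying (H1)–(H4), so that the embedding ‖w‖_{L^{G_*}(Ω)} ≤ C ‖w‖_{W^{s,G}_0(Ω)} holds. Let α > 0, 0 < β < p⁻ − 1, k ∈ L^{K̄}(Ω) positive with K(t) = G_*(t^{1/(β+1)}), and f nonnegative satisfying (A1) f ∈ L¹(Ω) if α > 1, (A2) f ∈ L^{Ḡ_*}(Ω) if α = 1, (A3) f ∈ L^{𝔉̄}(Ω) with 𝔉(t) = G_*(t^{1/(1−α)}) if α < 1. Fix ε ∈ (0,1) and define 𝒥_ε(w) = ∫∫_{ℝ^N×ℝ^N} G(|w(x)−w(y)|/|x−y|^s) dx dy/|x−y|^N − ∫_Ω ∫_0^{w(x)} [f(x)(σ+ε)^{−α} + k(x)(σ+ε)^{β}] dσ dx for nonnegative w ∈ W^{s,G}_0(Ω). Then 𝒥_ε is coercive: 𝒥_ε(w) → +∞ as ‖w‖_{W^{s,G}_0(Ω)} → ∞ over nonnegative w ∈ W^{s,G}_0(Ω). In particular, since 1 − α < p⁻, 1 < p⁻ and 1 + β < p⁻, one has 𝒥_ε(w)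 ≥ ‖w‖_{W^{s,G}_0(Ω)}^{p⁻} [1 − C(ε)(‖w‖^{1−α−p⁻} + ‖w‖^{1+β−p⁻} + ‖w‖^{−p⁻} + ‖w‖^{1−p⁻})] for ‖w‖ = ‖w‖_{W^{s,G}_0(Ω)} sufficiently large. -/
open MeasureTheory Filter Set
open scoped ENNReal

noncomputable section

/-- The norm of `W^{s,G}_0(Ω)`: the Gagliardo `(s,G)`-seminorm
`[u]_{s,G} = inf{λ > 0 : Φ_{s,G}(u/λ) ≤ 1}`. -/
def W0norm (G : ℝ → ℝ) (s : ℝ) (N : ℕ) (u : Euc N → ℝ) : ℝ :=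
  sInf {l : ℝ | 0 < l ∧ fracModular G s N (fun x => u x / l) ≤ 1}

/-- The Luxemburg norm `‖u‖_{L^A(Ω)}`. -/
def luxNorm (A : ℝ → ℝ) {N : ℕ} (Ω : Set (Euc N)) (u : Euc N → ℝ) : ℝ :=
  sInf {l : ℝ | 0 < l ∧ (∫⁻ x in Ω, ENNReal.ofReal (A (|u x| / l))) ≤ 1}

/-- Membership in the Orlicz space `L^A(Ω)`. -/
def MemOrlicz (A : ℝ → ℝ) {N : ℕ} (Ω : Set (Euc N)) (u : Euc N → ℝ) : Prop :=
  Measurable u ∧ ∃ l > 0, (∫⁻ x in Ω, ENNReal.ofReal (A (|u x| / l))) ≤ 1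

/-- The complementary (conjugate) function `Ā(t) = sup_{τ ≥ 0} (tτ − A(τ))`. -/
def conjFun (A : ℝ → ℝ) (t : ℝ) : ℝ := sSup ((fun τ => t * τ - A τ) '' Set.Ici 0)

/-- The penalized energy functional
`𝒥_ε(w) = Φ_{s,G}(w) − ∫_Ω ∫_0^{w(x)} (f(x)(σ+ε)^{−α} + k(x)(σ+ε)^{β}) dσ dx`. -/
def Jeps (G : ℝ → ℝ) (s : ℝ) (N : ℕ) (Ω : Set (Euc N)) (f k : Euc N → ℝ)
    (α β ε : ℝ) (w : Euc N → ℝ) : ℝ :=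
  (fracModular G s N w).toReal -
    ∫ x in Ω, ∫ σ in (0:ℝ)..(w x), (f x * (σ + ε) ^ (-α) + k x * (σ + ε) ^ β)

namespace IsNFunction

variable {G : ℝ → ℝ}

lemma map_zero (hG : IsNFunction G) : G 0 = 0 := (hG.2.2.1 0 le_rfl).2 rfl

lemma map_mul_le (hG : IsNFunction G) {c t : ℝ} (hc0 : 0 ≤ c) (hc1 : c ≤ 1) (ht : 0 ≤ t) :
    G (c * t) ≤ c * G t := by
  have h := hG.2.1.2 (mem_Ici.2 ht) (mem_Ici.2 (le_refl (0 : ℝ))) hc0 (sub_nonneg.2 hc1) (by ring)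
  simpa [hG.map_zero] using h

lemma nonneg_s19 (hG : IsNFunction G) {t : ℝ} (ht : 0 ≤ t) : 0 ≤ G t := by
  rcases ht.eq_or_lt with rfl | ht
  · exact hG.map_zero.ge
  have h1 : ∀ᶠ x in nhdsWithin (0 : ℝ) (Ioi 0), G x / x ≤ G t / t := by
    filter_upwards [Ioc_mem_nhdsGT ht] with x hx
    have h := hG.map_mul_le (c := x / t) (by have := hx.1; positivity)
      ((div_le_one ht).2 hx.2) ht.le
    rw [div_mul_cancel₀ _ ht.ne'] at h
    rw [div_le_iff₀ hx.1]
    calc G x ≤ x / t * G t := h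
      _ = G t / t * x := by ring
  have h2 := le_of_tendsto hG.2.2.2.1 h1
  by_contra! hneg
  exact absurd h2 (not_le.2 (div_neg_of_neg_of_pos hneg ht))

lemma pos (hG : IsNFunction G) {t : ℝ} (ht : 0 < t) : 0 < G t :=
  lt_of_le_of_ne (hG.nonneg_s19 ht.le) fun h => ht.ne' ((hG.2.2.1 t ht.le).1 h.symm)

lemma monotoneOn (hG : IsNFunction G) : MonotoneOn G (Ici 0) := by
  intro a ha b hb hab
  rcases (mem_Ici.1 hb).eq_or_lt with rfl | hb'
  · rw [le_antisymm hab ha]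
  have h := hG.map_mul_le (c := a / b) (div_nonneg ha hb) ((div_le_one hb').2 hab) hb
  rw [div_mul_cancel₀ _ hb'.ne'] at h
  exact h.trans (mul_le_of_le_one_left (hG.nonneg_s19 hb) ((div_le_one hb').2 hab))

end IsNFunction

section Growth

variable {G g g' : ℝ → ℝ} {pm pp : ℝ}

lemma deriv_pos_of_ratio (hG : IsNFunction G) (hGg : ∀ t : ℝ, 0 < t → HasDerivAt G (g t) t)
    (hpm : 1 < pm - 1) (hH4 : ∀ t : ℝ, 0 < t → pm - 1 ≤ t * g' t / g t) {t : ℝ} (ht : 0 < t) :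
    0 < g t := by
  have h0 : g t ≠ 0 := fun h => by
    have := hH4 t ht
    rw [h, div_zero] at this
    linarith
  refine lt_of_le_of_ne ?_ h0.symm
  have hmem : Ici (0 : ℝ) ∈ nhds t := Ici_mem_nhds ht
  have := (hG.monotoneOn).derivWithin_nonneg (x := t)
  rwa [derivWithin_of_mem_nhds hmem, (hGg t ht).deriv] at this

lemma le_mul_deriv (hG : IsNFunction G) (hGg : ∀ t : ℝ, 0 < t → HasDerivAt G (g t) t)
    (hgg' : ∀ t : ℝ, 0 < t → HasDerivAt g (g' t) t)
    (hpm : 1 < pm - 1) (hH4 : ∀ t : ℝ, 0 < t → pm - 1 ≤ t * g' t / g t) {t : ℝ} (ht : 0 < t) :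
    pm * G t ≤ t * g t := by
  have hgpos := fun {t : ℝ} (ht : 0 < t) => deriv_pos_of_ratio hG hGg hpm hH4 ht
  have hd : ∀ x : ℝ, 0 < x → HasDerivAt (fun x => x * g x - pm * G x)
      (1 * g x + x * g' x - pm * g x) x := fun x hx =>
    ((hasDerivAt_id x).mul (hgg' x hx)).sub ((hGg x hx).const_mul pm)
  have hmono : MonotoneOn (fun x => x * g x - pm * G x) (Ioi 0) := by
    refine monotoneOn_of_deriv_nonneg (convex_Ioi 0)
      (fun x hx => (hd x hx).continuousAt.continuousWithinAt)
      (fun x hx => (hd x (interior_subset hx)).differentiableAt.differentiableWithinAt)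
      fun x hx => ?_
    have hx : 0 < x := interior_subset hx
    rw [(hd x hx).deriv]
    have := (le_div_iff₀ (hgpos hx)).1 (hH4 x hx)
    linarith
  have hlim : Tendsto (fun x => -(pm * G x)) (nhdsWithin 0 (Ioi 0)) (nhds 0) := by
    have h := (hG.1 0 self_mem_Ici).mono_left (nhdsWithin_mono 0 Ioi_subset_Ici_self)
    rw [hG.map_zero] at h
    simpa using (h.const_mul pm).neg
  have : 0 ≤ t * g t - pm * G t := by
    refine le_of_tendsto hlim ?_
    filter_upwards [Ioc_mem_nhdsGT ht] with x hx
    have h1 := hmono hx.1 ht hx.2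
    have h2 := mul_pos hx.1 (hgpos hx.1)
    simp only at h1
    linarith
  linarith

lemma mul_deriv_le (hG : IsNFunction G) (hGg : ∀ t : ℝ, 0 < t → HasDerivAt G (g t) t)
    (hgg' : ∀ t : ℝ, 0 < t → HasDerivAt g (g' t) t)
    (hpm : 1 < pm - 1) (hpp : 0 ≤ pp) (hH4 : ∀ t : ℝ, 0 < t → pm - 1 ≤ t * g' t / g t)
    (hH4' : ∀ t : ℝ, 0 < t → t * g' t / g t ≤ pp - 1) {t : ℝ} (ht : 0 < t) :
    t * g t ≤ pp * G t := by
  have hgpos := fun {t : ℝ} (ht : 0 < t) => deriv_pos_of_ratio hG hGg hpm hH4 ht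
  have hgmono : MonotoneOn g (Ioi 0) := by
    refine monotoneOn_of_deriv_nonneg (convex_Ioi 0)
      (fun x hx => (hgg' x hx).continuousAt.continuousWithinAt)
      (fun x hx => (hgg' x (interior_subset hx)).differentiableAt.differentiableWithinAt)
      fun x hx => ?_
    have hx : 0 < x := interior_subset hx
    rw [(hgg' x hx).deriv]
    have h1 := (le_div_iff₀ (hgpos hx)).1 (hH4 x hx)
    have h2 : 0 < x * g' x := lt_of_lt_of_le (mul_pos (by linarith) (hgpos hx)) h1
    exact (pos_of_mul_pos_right h2 hx.le).le
  have hd : ∀ x : ℝ, 0 < x → HasDerivAt (fun x => pp * G x - x * g x)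
      (pp * g x - (1 * g x + x * g' x)) x := fun x hx =>
    ((hGg x hx).const_mul pp).sub ((hasDerivAt_id x).mul (hgg' x hx))
  have hmono : MonotoneOn (fun x => pp * G x - x * g x) (Ioi 0) := by
    refine monotoneOn_of_deriv_nonneg (convex_Ioi 0)
      (fun x hx => (hd x hx).continuousAt.continuousWithinAt)
      (fun x hx => (hd x (interior_subset hx)).differentiableAt.differentiableWithinAt)
      fun x hx => ?_
    have hx : 0 < x := interior_subset hx
    rw [(hd x hx).deriv]
    have := (div_le_iff₀ (hgpos hx)).1 (hH4' x hx)
    linarith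
  have hlim : Tendsto (fun x : ℝ => -(x * g t)) (nhdsWithin 0 (Ioi 0)) (nhds 0) := by
    have h : Tendsto (fun x : ℝ => -(x * g t)) (nhds 0) (nhds (-(0 * g t))) :=
      (tendsto_id.mul_const _).neg
    simpa using h.mono_left nhdsWithin_le_nhds
  have : 0 ≤ pp * G t - t * g t := by
    refine le_of_tendsto hlim ?_
    filter_upwards [Ioc_mem_nhdsGT ht] with x hx
    have h1 := hmono hx.1 ht hx.2
    have h2 := mul_le_mul_of_nonneg_left (hgmono hx.1 ht hx.2) (le_of_lt hx.1)
    have h3 := mul_nonneg hpp (hG.nonneg_s19 (le_of_lt hx.1))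
    simp only at h1
    linarith
  linarith

lemma hasDerivAt_mul_rpow_neg (hGg : ∀ t : ℝ, 0 < t → HasDerivAt G (g t) t) (p : ℝ) {x : ℝ}
    (hx : 0 < x) :
    HasDerivAt (fun x => G x * x ^ (-p)) ((x * g x - p * G x) * x ^ (-p - 1)) x := by
  refine ((hGg x hx).mul
    (Real.hasDerivAt_rpow_const (p := -p) (Or.inl hx.ne'))).congr_deriv ?_
  have : x ^ (-p) = x * x ^ (-p - 1) := by
    rw [Real.rpow_sub_one hx.ne']; field_simp
  rw [this]; ring

lemma rpow_mul_le_map_mul (hG : IsNFunction G) (hGg : ∀ t : ℝ, 0 < t → HasDerivAt G (g t) t)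
    {p : ℝ} (hp : ∀ t : ℝ, 0 < t → p * G t ≤ t * g t) {c t : ℝ} (hc : 1 ≤ c) (ht : 0 ≤ t) :
    c ^ p * G t ≤ G (c * t) := by
  rcases ht.eq_or_lt with rfl | ht
  · simp [hG.map_zero]
  have hc0 : 0 < c := by linarith
  have hmono : MonotoneOn (fun x => G x * x ^ (-p)) (Ioi 0) := by
    refine monotoneOn_of_deriv_nonneg (convex_Ioi 0)
      (fun x hx => (hasDerivAt_mul_rpow_neg hGg p hx).continuousAt.continuousWithinAt)
      (fun x hx => (hasDerivAt_mul_rpow_neg hGg p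
        (interior_subset hx)).differentiableAt.differentiableWithinAt) fun x hx => ?_
    have hx : 0 < x := interior_subset hx
    rw [(hasDerivAt_mul_rpow_neg hGg p hx).deriv]
    exact mul_nonneg (sub_nonneg.2 (hp x hx)) (Real.rpow_nonneg hx.le _)
  have h := hmono (mem_Ioi.2 ht) (mem_Ioi.2 (mul_pos hc0 ht)) (le_mul_of_one_le_left ht.le hc)
  simp only [Real.mul_rpow hc0.le ht.le, Real.rpow_neg hc0.le, Real.rpow_neg ht.le] at h
  have h1 : 0 < c ^ p := Real.rpow_pos_of_pos hc0 p
  have h2 : 0 < t ^ p := Real.rpow_pos_of_pos ht p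
  field_simp at h
  linarith

lemma map_mul_le_rpow_mul (hG : IsNFunction G) (hGg : ∀ t : ℝ, 0 < t → HasDerivAt G (g t) t)
    {p : ℝ} (hp : ∀ t : ℝ, 0 < t → t * g t ≤ p * G t) {c t : ℝ} (hc : 1 ≤ c) (ht : 0 ≤ t) :
    G (c * t) ≤ c ^ p * G t := by
  rcases ht.eq_or_lt with rfl | ht
  · simp [hG.map_zero]
  have hc0 : 0 < c := by linarith
  have hanti : AntitoneOn (fun x => G x * x ^ (-p)) (Ioi 0) := by
    refine antitoneOn_of_deriv_nonpos (convex_Ioi 0)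
      (fun x hx => (hasDerivAt_mul_rpow_neg hGg p hx).continuousAt.continuousWithinAt)
      (fun x hx => (hasDerivAt_mul_rpow_neg hGg p
        (interior_subset hx)).differentiableAt.differentiableWithinAt) fun x hx => ?_
    have hx : 0 < x := interior_subset hx
    rw [(hasDerivAt_mul_rpow_neg hGg p hx).deriv]
    exact mul_nonpos_of_nonpos_of_nonneg (sub_nonpos.2 (hp x hx)) (Real.rpow_nonneg hx.le _)
  have h := hanti (mem_Ioi.2 ht) (mem_Ioi.2 (mul_pos hc0 ht)) (le_mul_of_one_le_left ht.le hc)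
  simp only [Real.mul_rpow hc0.le ht.le, Real.rpow_neg hc0.le, Real.rpow_neg ht.le] at h
  have h1 : 0 < c ^ p := Real.rpow_pos_of_pos hc0 p
  have h2 : 0 < t ^ p := Real.rpow_pos_of_pos ht p
  field_simp at h
  linarith

end Growth

section Conjugate

variable {G g Ginv Gstar : ℝ → ℝ} {p r : ℝ}

lemma monotoneOn_inv (hG : IsNFunction G)
    (hGinv : ∀ t : ℝ, 0 ≤ t → 0 ≤ Ginv t ∧ G (Ginv t) = t ∧ Ginv (G t) = t) :
    MonotoneOn Ginv (Ici 0) := by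
  intro a ha b hb hab
  by_contra! hlt
  have h := hG.monotoneOn (hGinv b hb).1 (hGinv a ha).1 hlt.le
  rw [(hGinv a ha).2.1, (hGinv b hb).2.1] at h
  rw [le_antisymm hab h] at hlt
  exact lt_irrefl _ hlt

lemma inv_le_mul_rpow (hG : IsNFunction G) (hGg : ∀ t : ℝ, 0 < t → HasDerivAt G (g t) t)
    (hp0 : 0 < p) (hp : ∀ t : ℝ, 0 < t → p * G t ≤ t * g t)
    (hGinv : ∀ t : ℝ, 0 ≤ t → 0 ≤ Ginv t ∧ G (Ginv t) = t ∧ Ginv (G t) = t) :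
    ∃ C > 0, ∀ t : ℝ, 1 ≤ t → Ginv t ≤ C * t ^ (1 / p) := by
  have hG1 : 0 < G 1 := hG.pos one_pos
  refine ⟨1 + (1 / G 1) ^ (1 / p), by positivity, fun t ht => ?_⟩
  have ht0 : 0 ≤ t := by linarith
  obtain ⟨h0, h1, -⟩ := hGinv t ht0
  have ht1 : 1 ≤ t ^ (1 / p) := Real.one_le_rpow ht (by positivity)
  have hc : 0 ≤ (1 / G 1) ^ (1 / p) := by positivity
  rcases le_total (Ginv t) 1 with hle | hge
  · nlinarith [mul_nonneg hc (by linarith : 0 ≤ t ^ (1 / p))]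
  · have h := rpow_mul_le_map_mul hG hGg hp hge zero_le_one
    rw [mul_one, h1] at h
    have h2 : Ginv t ^ p ≤ 1 / G 1 * t := by
      rw [div_mul_eq_mul_div, one_mul, le_div_iff₀ hG1]; exact h
    have h3 : Ginv t ≤ (1 / G 1 * t) ^ (1 / p) := by
      have := Real.rpow_le_rpow (by positivity) h2 (by positivity : 0 ≤ 1 / p)
      rwa [← Real.rpow_mul h0, mul_one_div_cancel hp0.ne', Real.rpow_one] at this
    rw [Real.mul_rpow (by positivity) ht0] at h3
    linarith

lemma integrableOn_Ioc_inv_div (hG : IsNFunction G)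
    (hGinv : ∀ t : ℝ, 0 ≤ t → 0 ≤ Ginv t ∧ G (Ginv t) = t ∧ Ginv (G t) = t)
    (hfin : IntegrableOn (fun τ => Ginv τ / τ ^ r) (Ioc 0 1)) (t : ℝ) :
    IntegrableOn (fun τ => Ginv τ / τ ^ r) (Ioc 0 t) := by
  have h1 : IntegrableOn (fun τ => Ginv τ / τ ^ r) (Icc 1 t) := by
    have h2 : IntegrableOn Ginv (Icc 1 t) :=
      ((monotoneOn_inv hG hGinv).mono fun x hx =>
        mem_Ici.2 (zero_le_one.trans hx.1)).integrableOn_isCompact isCompact_Icc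
    have h3 : ContinuousOn (fun τ : ℝ => (τ ^ r)⁻¹) (Icc 1 t) := by
      intro x hx
      have hx0 : 0 < x := one_pos.trans_le hx.1
      exact ((Real.continuousAt_rpow_const x r (Or.inl hx0.ne')).inv₀
        (Real.rpow_pos_of_pos hx0 r).ne').continuousWithinAt
    exact h2.mul_continuousOn h3 isCompact_Icc
  refine (hfin.union h1).mono_set fun x hx => ?_
  rcases le_total x 1 with h | h
  · exact Or.inl ⟨hx.1, h⟩
  · exact Or.inr ⟨h, hx.2⟩

/-- The inverse `t ↦ ∫_0^t Ginv τ / τ ^ r dτ` of the Sobolev conjugate. -/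
def conjInv (Ginv : ℝ → ℝ) (r t : ℝ) : ℝ := ∫ τ in Ioc (0:ℝ) t, Ginv τ / τ ^ r

lemma inv_div_nonneg
    (hGinv : ∀ t : ℝ, 0 ≤ t → 0 ≤ Ginv t ∧ G (Ginv t) = t ∧ Ginv (G t) = t) {t : ℝ}
    (ht : 0 ≤ t) : 0 ≤ Ginv t / t ^ r :=
  div_nonneg (hGinv t ht).1 (Real.rpow_nonneg ht r)

lemma conjInv_mono (hG : IsNFunction G)
    (hGinv : ∀ t : ℝ, 0 ≤ t → 0 ≤ Ginv t ∧ G (Ginv t) = t ∧ Ginv (G t) = t)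
    (hfin : IntegrableOn (fun τ => Ginv τ / τ ^ r) (Ioc 0 1)) :
    Monotone (conjInv Ginv r) := by
  intro a b hab
  refine setIntegral_mono_set (integrableOn_Ioc_inv_div hG hGinv hfin b) ?_
    (Ioc_subset_Ioc_right hab).eventuallyLE
  filter_upwards [ae_restrict_mem measurableSet_Ioc] with x hx
  exact inv_div_nonneg hGinv hx.1.le

lemma conjInv_zero : conjInv Ginv r 0 = 0 := by simp [conjInv]

lemma exists_conjInv_eq (hG : IsNFunction G)
    (hGinv : ∀ t : ℝ, 0 ≤ t → 0 ≤ Ginv t ∧ G (Ginv t) = t ∧ Ginv (G t) = t)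
    (hfin : IntegrableOn (fun τ => Ginv τ / τ ^ r) (Ioc 0 1))
    (hinf : ¬ IntegrableOn (fun τ => Ginv τ / τ ^ r) (Ioi 1)) {u : ℝ} (hu : 0 ≤ u) :
    ∃ t : ℝ, 0 ≤ t ∧ conjInv Ginv r t = u := by
  have hint := integrableOn_Ioc_inv_div hG hGinv hfin
  have hex : ∃ T : ℝ, 1 ≤ T ∧ u ≤ conjInv Ginv r T := by
    by_contra! hcon
    refine hinf (integrableOn_Ioi_of_intervalIntegral_norm_bounded (l := atTop) (b := id) u 1
      (fun i => (hint i).mono_set (Ioc_subset_Ioc_left zero_le_one)) tendsto_id ?_)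
    filter_upwards [eventually_ge_atTop (1 : ℝ)] with T hT
    refine le_trans ?_ (hcon T hT).le
    rw [id, intervalIntegral.integral_of_le hT, conjInv]
    calc ∫ x in Ioc 1 T, ‖Ginv x / x ^ r‖ = ∫ x in Ioc 1 T, Ginv x / x ^ r := by
          refine setIntegral_congr_fun measurableSet_Ioc fun x hx => ?_
          exact Real.norm_of_nonneg (inv_div_nonneg hGinv (zero_le_one.trans hx.1.le))
      _ ≤ _ := by
          refine setIntegral_mono_set (hint T) ?_
            (Ioc_subset_Ioc_left zero_le_one).eventuallyLE
          filter_upwards [ae_restrict_mem measurableSet_Ioc] with x hx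
          exact inv_div_nonneg hGinv hx.1.le
  obtain ⟨T, hT, huT⟩ := hex
  have hcont : ContinuousOn (conjInv Ginv r) (Icc 0 T) :=
    intervalIntegral.continuousOn_primitive
      ((integrableOn_Icc_iff_integrableOn_Ioc enorm_ne_top).2 (hint T))
  obtain ⟨t, ht, hts⟩ := intermediate_value_Icc (zero_le_one.trans hT) hcont
    ⟨conjInv_zero.trans_le hu, huT⟩
  exact ⟨t, ht.1, hts⟩

lemma exists_conjInv_le (hG : IsNFunction G) (hGg : ∀ t : ℝ, 0 < t → HasDerivAt G (g t) t)
    (hp0 : 0 < p) (hp : ∀ t : ℝ, 0 < t → p * G t ≤ t * g t)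
    (hGinv : ∀ t : ℝ, 0 ≤ t → 0 ≤ Ginv t ∧ G (Ginv t) = t ∧ Ginv (G t) = t) (hr : 1 ≤ r)
    (hfin : IntegrableOn (fun τ => Ginv τ / τ ^ r) (Ioc 0 1)) :
    ∃ D > 0, ∀ t : ℝ, 1 ≤ t → conjInv Ginv r t ≤ D * t ^ (1 / p) := by
  obtain ⟨C, hC, hCb⟩ := inv_le_mul_rpow hG hGg hp0 hp hGinv
  have hint := integrableOn_Ioc_inv_div hG hGinv hfin
  have hH1 : 0 ≤ conjInv Ginv r 1 := by
    rw [← conjInv_zero (Ginv := Ginv) (r := r)]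
    exact conjInv_mono hG hGinv hfin zero_le_one
  refine ⟨conjInv Ginv r 1 + C * p, by positivity, fun t ht => ?_⟩
  have ht1 : 1 ≤ t ^ (1 / p) := Real.one_le_rpow ht (by positivity)
  have hsplit : conjInv Ginv r t = conjInv Ginv r 1 + ∫ τ in Ioc 1 t, Ginv τ / τ ^ r := by
    rw [conjInv, ← Ioc_union_Ioc_eq_Ioc zero_le_one ht]
    exact setIntegral_union (Ioc_disjoint_Ioc_of_le le_rfl) measurableSet_Ioc hfin
      ((hint t).mono_set (Ioc_subset_Ioc_left zero_le_one))
  have hmem : (0 : ℝ) ∉ uIcc 1 t := by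
    rw [uIcc_of_le ht]; exact fun h => absurd h.1 (by norm_num)
  have hbound : ∫ τ in Ioc 1 t, Ginv τ / τ ^ r ≤ C * p * (t ^ (1 / p) - 1) := by
    have hI : IntervalIntegrable (fun τ : ℝ => C * τ ^ (1 / p - 1)) volume 1 t :=
      (intervalIntegral.intervalIntegrable_rpow (Or.inr hmem)).const_mul C
    calc ∫ τ in Ioc 1 t, Ginv τ / τ ^ r ≤ ∫ τ in Ioc 1 t, C * τ ^ (1 / p - 1) := by
          refine setIntegral_mono_on ((hint t).mono_set (Ioc_subset_Ioc_left zero_le_one))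
            ((intervalIntegrable_iff_integrableOn_Ioc_of_le ht).1 hI) measurableSet_Ioc
            fun x hx => ?_
          have hx0 : 0 < x := one_pos.trans hx.1
          have hxr : x ≤ x ^ r := by
            simpa using Real.rpow_le_rpow_of_exponent_le hx.1.le hr
          calc Ginv x / x ^ r ≤ C * x ^ (1 / p) / x := by
                gcongr
                exact hCb x hx.1.le
            _ = C * x ^ (1 / p - 1) := by rw [Real.rpow_sub_one hx0.ne', mul_div_assoc]
      _ = C * p * (t ^ (1 / p) - 1) := by
          rw [← intervalIntegral.integral_of_le ht, intervalIntegral.integral_const_mul,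
            integral_rpow (Or.inl (by have : 0 < 1 / p := by positivity
                                      linarith))]
          simp only [sub_add_cancel, Real.one_rpow]
          field_simp
  rw [hsplit]
  nlinarith [mul_nonneg hH1 (sub_nonneg.2 ht1), mul_pos hC hp0]

/-- The properties of the Sobolev conjugate used below: it is nondecreasing on `[0,∞)`, attains
every nonnegative value, and grows at least like `t ^ p`. -/
structure ConjGrowth (A : ℝ → ℝ) (p : ℝ) : Prop where
  map_zero : A 0 = 0
  monotoneOn : MonotoneOn A (Ici 0)
  exists_pos_eq : ∀ δ : ℝ, 0 < δ → ∃ u > 0, A u = δ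
  exists_rpow_le : ∃ D > 0, ∀ u : ℝ, 0 ≤ u → (u / D) ^ p ≤ A u + 1

lemma conjGrowth_of_conjInv (hG : IsNFunction G)
    (hGg : ∀ t : ℝ, 0 < t → HasDerivAt G (g t) t)
    (hp0 : 0 < p) (hp : ∀ t : ℝ, 0 < t → p * G t ≤ t * g t)
    (hGinv : ∀ t : ℝ, 0 ≤ t → 0 ≤ Ginv t ∧ G (Ginv t) = t ∧ Ginv (G t) = t) (hr : 1 ≤ r)
    (hfin : IntegrableOn (fun τ => Ginv τ / τ ^ r) (Ioc 0 1))
    (hinf : ¬ IntegrableOn (fun τ => Ginv τ / τ ^ r) (Ioi 1))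
    (hGstar : ∀ t : ℝ, 0 ≤ t → Gstar (conjInv Ginv r t) = t) : ConjGrowth Gstar p := by
  have hmono := conjInv_mono hG hGinv hfin
  have hsurj := fun {u : ℝ} (hu : 0 ≤ u) => exists_conjInv_eq hG hGinv hfin hinf hu
  have hzero : Gstar 0 = 0 := by simpa [conjInv_zero] using hGstar 0 le_rfl
  refine ⟨hzero, ?_, ?_, ?_⟩
  · intro u hu v hv huv
    obtain ⟨a, ha, rfl⟩ := hsurj hu
    obtain ⟨b, hb, rfl⟩ := hsurj hv
    by_contra! hlt
    rw [hGstar a ha, hGstar b hb] at hlt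
    have h := le_antisymm huv (hmono hlt.le)
    have h2 := hGstar a ha
    rw [h, hGstar b hb] at h2
    exact hlt.ne h2
  · intro δ hδ
    refine ⟨conjInv Ginv r δ, lt_of_le_of_ne ?_ fun h => ?_, hGstar δ hδ.le⟩
    · rw [← conjInv_zero (Ginv := Ginv) (r := r)]
      exact hmono hδ.le
    · have h2 := hGstar δ hδ.le
      rw [← h, hzero] at h2
      exact hδ.ne h2
  · obtain ⟨D, hD, hDb⟩ := exists_conjInv_le hG hGg hp0 hp hGinv hr hfin
    refine ⟨D, hD, fun u hu => ?_⟩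
    obtain ⟨t, ht, rfl⟩ := hsurj hu
    rw [hGstar t ht]
    rcases le_total t 1 with h1 | h1
    · have h2 : conjInv Ginv r t ≤ D := (hmono h1).trans (by simpa using hDb 1 le_rfl)
      have := Real.rpow_le_one (div_nonneg hu hD.le) ((div_le_one hD).2 h2) hp0.le
      linarith
    · have h2 : conjInv Ginv r t / D ≤ t ^ (1 / p) := by
        rw [div_le_iff₀ hD, mul_comm]; exact hDb t h1
      have h3 := Real.rpow_le_rpow (div_nonneg hu hD.le) h2 hp0.le
      rw [← Real.rpow_mul ht, one_div_mul_cancel hp0.ne', Real.rpow_one] at h3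
      linarith

namespace ConjGrowth

variable {A : ℝ → ℝ} {q : ℝ}

lemma nonneg_s19 (hA : ConjGrowth A p) {t : ℝ} (ht : 0 ≤ t) : 0 ≤ A t := by
  rw [← hA.map_zero]
  exact hA.monotoneOn self_mem_Ici ht ht

lemma bddAbove_conj (hA : ConjGrowth A p) (hq : 0 < q) (hqp : q < p) {t : ℝ} (ht : 0 ≤ t) :
    BddAbove ((fun τ => t * τ - A (τ ^ (1 / q))) '' Ici 0) := by
  obtain ⟨D, hD, hDb⟩ := hA.exists_rpow_le
  have hconj : (p / q).HolderConjugate (Real.conjExponent (p / q)) :=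
    Real.HolderConjugate.conjExponent ((one_lt_div hq).2 hqp)
  refine ⟨(t * D ^ q) ^ (Real.conjExponent (p / q)) / Real.conjExponent (p / q) + 1, ?_⟩
  rintro _ ⟨τ, hτ, rfl⟩
  rw [mem_Ici] at hτ
  have h1 := Real.young_inequality_of_nonneg (a := t * D ^ q) (b := τ / D ^ q) (by positivity)
    (by positivity) hconj.symm
  have h2 : t * D ^ q * (τ / D ^ q) = t * τ := by field_simp
  have h3 : (τ / D ^ q) ^ (p / q) = (τ ^ (1 / q) / D) ^ p := by
    have : τ / D ^ q = (τ ^ (1 / q) / D) ^ q := by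
      rw [Real.div_rpow (by positivity) hD.le, ← Real.rpow_mul hτ, one_div_mul_cancel hq.ne',
        Real.rpow_one]
    rw [this, ← Real.rpow_mul (by positivity), mul_div_cancel₀ _ hq.ne']
  have h4 := hDb (τ ^ (1 / q)) (by positivity)
  have h5 : (τ / D ^ q) ^ (p / q) / (p / q) ≤ (τ / D ^ q) ^ (p / q) :=
    div_le_self (by positivity) ((one_lt_div hq).2 hqp).le
  rw [h2] at h1
  rw [h3] at h5 h1
  simp only
  linarith

lemma young (hA : ConjGrowth A p) (hq : 0 < q) (hqp : q < p) {t u : ℝ} (ht : 0 ≤ t)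
    (hu : 0 ≤ u) :
    t * u ^ q ≤ conjFun (fun τ => A (τ ^ (1 / q))) t + A u := by
  have h := le_csSup (hA.bddAbove_conj hq hqp ht)
    (mem_image_of_mem _ (mem_Ici.2 (Real.rpow_nonneg hu q)))
  simp only [← Real.rpow_mul hu, mul_one_div_cancel hq.ne', Real.rpow_one] at h
  rw [conjFun]
  linarith

lemma conjFun_nonneg (hA : ConjGrowth A p) (hq : 0 < q) (hqp : q < p) {t : ℝ} (ht : 0 ≤ t) :
    0 ≤ conjFun (fun τ => A (τ ^ (1 / q))) t := by
  have h := hA.young hq hqp ht le_rfl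
  simpa [Real.zero_rpow hq.ne', hA.map_zero] using h

end ConjGrowth

end Conjugate

section Modular

variable {G g : ℝ → ℝ} {s p : ℝ} {N : ℕ} {Ω : Set (Euc N)}

lemma fracModular_mono (hG : IsNFunction G) {u v : Euc N → ℝ}
    (h : ∀ x y, |u x - u y| ≤ |v x - v y|) : fracModular G s N u ≤ fracModular G s N v := by
  refine lintegral_mono fun q => ENNReal.ofReal_le_ofReal ?_
  refine div_le_div_of_nonneg_right ?_ (by positivity)
  refine hG.monotoneOn (mem_Ici.2 (by positivity)) (mem_Ici.2 (by positivity)) ?_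
  exact div_le_div_of_nonneg_right (h _ _) (by positivity)

lemma abs_sub_mul_div (w : Euc N → ℝ) {c : ℝ} (hc : 0 < c) (q : Euc N × Euc N) :
    |w q.1 - w q.2| / dist q.1 q.2 ^ s =
      c * (|w q.1 / c - w q.2 / c| / dist q.1 q.2 ^ s) := by
  rw [← sub_div, abs_div, abs_of_pos hc]
  field_simp

lemma ofReal_rpow_mul_fracModular_le (hG : IsNFunction G)
    (hGg : ∀ t : ℝ, 0 < t → HasDerivAt G (g t) t)
    (hp : ∀ t : ℝ, 0 < t → p * G t ≤ t * g t) (w : Euc N → ℝ) {c : ℝ} (hc : 1 ≤ c) :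
    ENNReal.ofReal (c ^ p) * fracModular G s N (fun x => w x / c) ≤ fracModular G s N w := by
  rw [fracModular, fracModular, ← lintegral_const_mul' _ _ ENNReal.ofReal_ne_top]
  refine lintegral_mono fun q => ?_
  rw [← ENNReal.ofReal_mul (by positivity)]
  refine ENNReal.ofReal_le_ofReal ?_
  rw [abs_sub_mul_div w (one_pos.trans_le hc), ← mul_div_assoc (c ^ p)]
  exact div_le_div_of_nonneg_right (rpow_mul_le_map_mul hG hGg hp hc (by positivity))
    (by positivity)

lemma fracModular_le_ofReal_rpow_mul (hG : IsNFunction G)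
    (hGg : ∀ t : ℝ, 0 < t → HasDerivAt G (g t) t)
    (hp : ∀ t : ℝ, 0 < t → t * g t ≤ p * G t) (w : Euc N → ℝ) {c : ℝ} (hc : 1 ≤ c) :
    fracModular G s N w ≤ ENNReal.ofReal (c ^ p) * fracModular G s N (fun x => w x / c) := by
  rw [fracModular, fracModular, ← lintegral_const_mul' _ _ ENNReal.ofReal_ne_top]
  refine lintegral_mono fun q => ?_
  rw [← ENNReal.ofReal_mul (by positivity)]
  refine ENNReal.ofReal_le_ofReal ?_
  rw [abs_sub_mul_div w (one_pos.trans_le hc), ← mul_div_assoc (c ^ p)]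
  exact div_le_div_of_nonneg_right (map_mul_le_rpow_mul hG hGg hp hc (by positivity))
    (by positivity)

lemma fracModular_lt_top (hG : IsNFunction G) (hGg : ∀ t : ℝ, 0 < t → HasDerivAt G (g t) t)
    (hp : ∀ t : ℝ, 0 < t → t * g t ≤ p * G t) {w : Euc N → ℝ} (hw : MemW0 G s Ω w) :
    fracModular G s N w < ⊤ := by
  obtain ⟨l, hl, hfin⟩ := hw.2.2.1
  rcases le_total 1 l with h | h
  · exact (fracModular_le_ofReal_rpow_mul hG hGg hp w h).trans_lt
      (ENNReal.mul_lt_top ENNReal.ofReal_lt_top hfin)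
  · refine (fracModular_mono hG fun x y => ?_).trans_lt hfin
    rw [← sub_div, abs_div, abs_of_pos hl]
    exact le_div_self (abs_nonneg _) hl h

lemma W0norm_rpow_le_fracModular (hG : IsNFunction G)
    (hGg : ∀ t : ℝ, 0 < t → HasDerivAt G (g t) t) (hp0 : 0 < p)
    (hp : ∀ t : ℝ, 0 < t → p * G t ≤ t * g t) {w : Euc N → ℝ} (hn : 1 < W0norm G s N w)
    (hfin : fracModular G s N w ≠ ⊤) :
    W0norm G s N w ^ p ≤ (fracModular G s N w).toReal := by
  have hlim : Tendsto (fun c : ℝ => c ^ p) (nhdsWithin (W0norm G s N w) (Iio (W0norm G s N w)))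
      (nhds (W0norm G s N w ^ p)) :=
    ((Real.continuousAt_rpow_const _ p (Or.inr hp0.le)).tendsto).mono_left nhdsWithin_le_nhds
  refine le_of_tendsto hlim ?_
  filter_upwards [Ioo_mem_nhdsLT hn] with c hc
  have hc0 : 0 < c := one_pos.trans hc.1
  have h1 : 1 ≤ fracModular G s N (fun x => w x / c) := by
    by_contra! hlt
    have hle : W0norm G s N w ≤ c := csInf_le ⟨0, fun l hl => hl.1.le⟩ ⟨hc0, hlt.le⟩
    exact absurd hle (not_le.2 hc.2)
  have h2 : ENNReal.ofReal (c ^ p) ≤ fracModular G s N w :=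
    (le_mul_of_one_le_right (zero_le) h1).trans
      (ofReal_rpow_mul_fracModular_le hG hGg hp w hc.1.le)
  exact (ENNReal.ofReal_le_iff_le_toReal hfin).1 h2

lemma abs_min_abs_sub_le (a b n : ℝ) : |min |a| n - min |b| n| ≤ |a - b| :=
  (abs_min_sub_min_le_max _ _ _ _).trans (by simpa using abs_abs_sub_abs_le a b)

lemma memW0_truncation (hG : IsNFunction G) {w : Euc N → ℝ} (hw : MemW0 G s Ω w) {n : ℝ}
    (hn : 0 ≤ n) : MemW0 G s Ω (fun x => min |w x| n) := by
  obtain ⟨hm, ⟨l, hl, hle⟩, ⟨l', hl', hlt⟩, h0⟩ := hw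
  refine ⟨(continuous_abs.measurable.comp hm).min measurable_const, ⟨l, hl, ?_⟩,
    ⟨l', hl', ?_⟩, fun x hx => by simp [h0 x hx, hn]⟩
  · refine (lintegral_mono fun x => ENNReal.ofReal_le_ofReal ?_).trans hle
    refine hG.monotoneOn (mem_Ici.2 (by positivity)) (mem_Ici.2 (by positivity)) ?_
    refine div_le_div_of_nonneg_right ?_ hl.le
    rw [abs_of_nonneg (le_min (abs_nonneg _) hn)]
    exact min_le_left _ _
  · refine (fracModular_mono hG fun x y => ?_).trans_lt hlt
    rw [← sub_div, ← sub_div, abs_div, abs_div]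
    exact div_le_div_of_nonneg_right (abs_min_abs_sub_le _ _ _) (abs_nonneg _)

lemma W0norm_truncation_le (hG : IsNFunction G) {w : Euc N → ℝ} (hn : 0 < W0norm G s N w)
    (n : ℝ) : W0norm G s N (fun x => min |w x| n) ≤ W0norm G s N w := by
  have hne : {l : ℝ | 0 < l ∧ fracModular G s N (fun x => w x / l) ≤ 1}.Nonempty := by
    by_contra! h
    rw [W0norm, h, Real.sInf_empty] at hn
    exact lt_irrefl _ hn
  refine csInf_le_csInf ⟨0, fun l hl => hl.1.le⟩ hne fun l hl => ⟨hl.1, ?_⟩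
  refine (fracModular_mono hG fun x y => ?_).trans hl.2
  rw [← sub_div, ← sub_div, abs_div, abs_div]
  exact div_le_div_of_nonneg_right (abs_min_abs_sub_le _ _ _) (abs_nonneg _)

end Modular

section Orlicz

variable {A : ℝ → ℝ} {p q : ℝ} {N : ℕ} {Ω : Set (Euc N)}

lemma ConjGrowth.measurable_comp (hA : ConjGrowth A p) {u : Euc N → ℝ} (hu : Measurable u)
    (h0 : ∀ x, 0 ≤ u x) : Measurable fun x => ENNReal.ofReal (A (u x)) := by
  have hm : Monotone fun t => A (max t 0) := fun a b hab =>
    hA.monotoneOn (mem_Ici.2 (le_max_right _ _)) (mem_Ici.2 (le_max_right _ _))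
      (max_le_max_right 0 hab)
  have := (hm.measurable.comp hu).ennreal_ofReal
  simpa only [Function.comp_def, max_eq_left (h0 _)] using this

lemma lintegral_le_one_of_luxNorm_lt (hA : ConjGrowth A p) (hΩ : volume Ω ≠ ⊤)
    {u : Euc N → ℝ} {n b : ℝ} (hn : ∀ x, |u x| ≤ n) (hlt : luxNorm A Ω u < b) :
    ∫⁻ x in Ω, ENNReal.ofReal (A (|u x| / b)) ≤ 1 := by
  have hne : {l : ℝ | 0 < l ∧ (∫⁻ x in Ω, ENNReal.ofReal (A (|u x| / l))) ≤ 1}.Nonempty := by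
    obtain ⟨v, hv, hvA⟩ := hA.exists_pos_eq (1 / ((volume Ω).toReal + 1)) (by positivity)
    have hm : 0 < |n| + 1 := by positivity
    refine ⟨(|n| + 1) / v, by positivity, ?_⟩
    have hvol : 0 ≤ (volume Ω).toReal := ENNReal.toReal_nonneg
    calc ∫⁻ x in Ω, ENNReal.ofReal (A (|u x| / ((|n| + 1) / v)))
        ≤ ∫⁻ _ in Ω, ENNReal.ofReal (1 / ((volume Ω).toReal + 1)) := by
          refine lintegral_mono fun x => ENNReal.ofReal_le_ofReal ?_
          rw [← hvA]
          refine hA.monotoneOn (mem_Ici.2 (by positivity)) (mem_Ici.2 hv.le) ?_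
          rw [div_div_eq_mul_div, div_le_iff₀ hm, mul_comm]
          exact mul_le_mul_of_nonneg_left (((hn x).trans (le_abs_self n)).trans (by linarith))
            hv.le
      _ = ENNReal.ofReal (1 / ((volume Ω).toReal + 1) * (volume Ω).toReal) := by
          rw [lintegral_const, Measure.restrict_apply_univ, ENNReal.ofReal_mul (by positivity),
            ENNReal.ofReal_toReal hΩ]
      _ ≤ 1 := by
          rw [ENNReal.ofReal_le_one, one_div, inv_mul_le_iff₀ (by positivity)]
          linarith
  obtain ⟨l, ⟨hl0, hl⟩, hlb⟩ := exists_lt_of_csInf_lt hne hlt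
  refine (lintegral_mono fun x => ENNReal.ofReal_le_ofReal ?_).trans hl
  have hb : 0 < b := hl0.trans hlb
  exact hA.monotoneOn (mem_Ici.2 (by positivity)) (mem_Ici.2 (by positivity))
    (div_le_div_of_nonneg_left (abs_nonneg _) hl0 hlb.le)

lemma lintegral_le_one_of_embedding {G : ℝ → ℝ} {s C₀ : ℝ} (hG : IsNFunction G)
    (hA : ConjGrowth A p) (hΩ : volume Ω ≠ ⊤)
    (hEmb : ∀ w : Euc N → ℝ, MemW0 G s Ω w → luxNorm A Ω w ≤ C₀ * W0norm G s N w)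
    (hC₀ : 0 < C₀) {w : Euc N → ℝ} (hw : MemW0 G s Ω w) (hn : 0 < W0norm G s N w) :
    ∫⁻ x in Ω, ENNReal.ofReal (A (|w x| / (2 * C₀ * W0norm G s N w))) ≤ 1 := by
  set b := 2 * C₀ * W0norm G s N w with hb
  have hb0 : 0 < b := by positivity
  have htrunc : ∀ n : ℕ, ∫⁻ x in Ω, ENNReal.ofReal (A (|min |w x| (n : ℝ)| / b)) ≤ 1 := by
    intro n
    refine lintegral_le_one_of_luxNorm_lt hA hΩ (n := n) (fun x => ?_) ?_
    · rw [abs_of_nonneg (le_min (abs_nonneg _) n.cast_nonneg)]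
      exact min_le_right _ _
    · refine (hEmb _ (memW0_truncation hG hw n.cast_nonneg)).trans_lt ?_
      have h1 := mul_le_mul_of_nonneg_left (W0norm_truncation_le hG hn (n : ℝ)) hC₀.le
      have h2 := mul_pos hC₀ hn
      linarith
  have hmeas : ∀ n : ℕ, Measurable fun x => ENNReal.ofReal (A (|min |w x| (n : ℝ)| / b)) :=
    fun n => hA.measurable_comp (((memW0_truncation hG hw n.cast_nonneg).1.abs).div_const b)
      fun x => by positivity
  calc ∫⁻ x in Ω, ENNReal.ofReal (A (|w x| / b))
      = ∫⁻ x in Ω, liminf (fun n : ℕ => ENNReal.ofReal (A (|min |w x| (n : ℝ)| / b))) atTop := by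
        refine lintegral_congr fun x => ?_
        refine (Tendsto.liminf_eq (tendsto_const_nhds.congr' ?_)).symm
        filter_upwards [eventually_ge_atTop ⌈|w x|⌉₊] with n hn
        rw [min_eq_left ((Nat.le_ceil _).trans (Nat.cast_le.2 hn)), abs_abs]
    _ ≤ liminf (fun n : ℕ => ∫⁻ x in Ω, ENNReal.ofReal (A (|min |w x| (n : ℝ)| / b))) atTop :=
        lintegral_liminf_le hmeas
    _ ≤ liminf (fun _ : ℕ => (1 : ℝ≥0∞)) atTop :=
        liminf_le_liminf (Eventually.of_forall htrunc)
    _ = 1 := by simp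

lemma lintegral_abs_mul_rpow_le (hA : ConjGrowth A p) (hq : 0 < q) (hqp : q < p)
    {h u : Euc N → ℝ} {l b : ℝ} (hl : 0 < l) (hb : 0 < b)
    (hh : ∫⁻ x in Ω, ENNReal.ofReal (conjFun (fun τ => A (τ ^ (1 / q))) (|h x| / l)) ≤ 1)
    (hum : Measurable u) {c : ℝ≥0∞} (hu : ∫⁻ x in Ω, ENNReal.ofReal (A (|u x| / b)) ≤ c) :
    ∫⁻ x in Ω, ENNReal.ofReal (|h x| * |u x| ^ q) ≤ ENNReal.ofReal (l * b ^ q) * (1 + c) := by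
  calc ∫⁻ x in Ω, ENNReal.ofReal (|h x| * |u x| ^ q)
      ≤ ∫⁻ x in Ω, ENNReal.ofReal (l * b ^ q) *
          (ENNReal.ofReal (conjFun (fun τ => A (τ ^ (1 / q))) (|h x| / l)) +
            ENNReal.ofReal (A (|u x| / b))) := by
        refine lintegral_mono fun x => ?_
        rw [← ENNReal.ofReal_add (hA.conjFun_nonneg hq hqp (by positivity))
          (hA.nonneg_s19 (by positivity)), ← ENNReal.ofReal_mul (by positivity)]
        refine ENNReal.ofReal_le_ofReal ?_
        have h1 := hA.young hq hqp (t := |h x| / l) (u := |u x| / b) (by positivity)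
          (by positivity)
        calc |h x| * |u x| ^ q = l * b ^ q * (|h x| / l * (|u x| / b) ^ q) := by
              rw [Real.div_rpow (abs_nonneg _) hb.le]
              field_simp
          _ ≤ _ := mul_le_mul_of_nonneg_left h1 (by positivity)
    _ = ENNReal.ofReal (l * b ^ q) *
          ((∫⁻ x in Ω, ENNReal.ofReal (conjFun (fun τ => A (τ ^ (1 / q))) (|h x| / l))) +
            ∫⁻ x in Ω, ENNReal.ofReal (A (|u x| / b))) := by
        rw [lintegral_const_mul' _ _ ENNReal.ofReal_ne_top, lintegral_add_right _
          (hA.measurable_comp (hum.abs.div_const b) fun x => by positivity)]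
    _ ≤ _ := by gcongr

lemma exists_lintegral_abs_mul_rpow_le {G : ℝ → ℝ} {s C₀ : ℝ} (hG : IsNFunction G)
    (hA : ConjGrowth A p) (hΩ : volume Ω ≠ ⊤)
    (hEmb : ∀ w : Euc N → ℝ, MemW0 G s Ω w → luxNorm A Ω w ≤ C₀ * W0norm G s N w)
    (hC₀ : 0 < C₀) (hq : 0 < q) (hqp : q < p) {h : Euc N → ℝ}
    (hh : MemOrlicz (conjFun fun τ => A (τ ^ (1 / q))) Ω h) :
    ∃ C : ℝ, 0 ≤ C ∧ ∀ w : Euc N → ℝ, MemW0 G s Ω w → 0 < W0norm G s N w →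
      ∫⁻ x in Ω, ENNReal.ofReal (|h x| * |w x| ^ q) ≤
        ENNReal.ofReal (C * W0norm G s N w ^ q) := by
  obtain ⟨-, l, hl, hle⟩ := hh
  refine ⟨l * (2 * C₀) ^ q * 2, by positivity, fun w hw hn => ?_⟩
  refine (lintegral_abs_mul_rpow_le hA hq hqp hl (by positivity) hle hw.1
    (lintegral_le_one_of_embedding hG hA hΩ hEmb hC₀ hw hn)).trans_eq ?_
  rw [one_add_one_eq_two, ← ENNReal.ofReal_ofNat, ← ENNReal.ofReal_mul (by positivity),
    Real.mul_rpow (by positivity) hn.le]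
  congr 1
  ring

lemma exists_lintegral_abs_le (hA : ConjGrowth A p) (hΩ : volume Ω ≠ ⊤) (hq : 0 < q)
    (hqp : q < p) {h : Euc N → ℝ} (hh : MemOrlicz (conjFun fun τ => A (τ ^ (1 / q))) Ω h) :
    ∃ C : ℝ, 0 ≤ C ∧ ∫⁻ x in Ω, ENNReal.ofReal |h x| ≤ ENNReal.ofReal C := by
  obtain ⟨-, l, hl, hle⟩ := hh
  have h1 := lintegral_abs_mul_rpow_le (u := fun _ => 1) (b := 1) hA hq hqp hl one_pos hle
    measurable_const le_rfl
  simp only [abs_one, Real.one_rpow, mul_one] at h1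
  refine ⟨_, ENNReal.toReal_nonneg, h1.trans_eq (ENNReal.ofReal_toReal ?_).symm⟩
  rw [lintegral_const, Measure.restrict_apply_univ]
  finiteness

end Orlicz

section Primitive

variable {α β ε t : ℝ}

lemma intervalIntegrable_add_rpow (hε : 0 < ε) (ht : 0 ≤ t) (r : ℝ) :
    IntervalIntegrable (fun σ : ℝ => (σ + ε) ^ r) volume 0 t := by
  refine ContinuousOn.intervalIntegrable fun σ hσ => ?_
  rw [uIcc_of_le ht] at hσ
  have h : σ + ε ≠ 0 := by have := hσ.1; positivity
  exact ((continuousAt_id.add continuousAt_const).rpow_const (Or.inl h)).continuousWithinAt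

lemma integral_add_rpow (hε : 0 < ε) (ht : 0 ≤ t) {r : ℝ} (hr : r ≠ -1) :
    ∫ σ in (0:ℝ)..t, (σ + ε) ^ r = ((t + ε) ^ (r + 1) - ε ^ (r + 1)) / (r + 1) := by
  have hmem : (0 : ℝ) ∉ uIcc (0 + ε) (t + ε) := by
    rw [uIcc_of_le (by linarith)]
    exact fun h => absurd h.1 (by linarith)
  rw [intervalIntegral.integral_comp_add_right (fun σ : ℝ => σ ^ r) ε,
    integral_rpow (Or.inr ⟨hr, hmem⟩), zero_add]

lemma integral_add_rpow_nonneg (hε : 0 < ε) (ht : 0 ≤ t) (r : ℝ) :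
    0 ≤ ∫ σ in (0:ℝ)..t, (σ + ε) ^ r :=
  intervalIntegral.integral_nonneg ht fun σ hσ => by have := hσ.1; positivity

lemma integral_add_rpow_neg_le_of_lt_one (hε : 0 < ε) (ht : 0 ≤ t) (hα : α < 1) (hα0 : 0 < α) :
    ∫ σ in (0:ℝ)..t, (σ + ε) ^ (-α) ≤ 1 / (1 - α) * t ^ (1 - α) := by
  rw [integral_add_rpow hε ht (fun h => by linarith), neg_add_eq_sub, one_div_mul_eq_div]
  have h := Real.rpow_add_le_add_rpow ht hε.le (by linarith : 0 ≤ 1 - α) (by linarith)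
  exact div_le_div_of_nonneg_right (by linarith) (by linarith)

lemma integral_add_rpow_neg_le_of_one_lt (hε : 0 < ε) (ht : 0 ≤ t) (hα : 1 < α) :
    ∫ σ in (0:ℝ)..t, (σ + ε) ^ (-α) ≤ ε ^ (1 - α) / (α - 1) := by
  rw [integral_add_rpow hε ht (fun h => by linarith), neg_add_eq_sub, ← neg_div_neg_eq, neg_sub,
    neg_sub]
  have h : 0 ≤ (t + ε) ^ (1 - α) := by positivity
  exact div_le_div_of_nonneg_right (by linarith) (by linarith)

lemma integral_add_rpow_neg_one_le (hε : 0 < ε) (ht : 0 ≤ t) :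
    ∫ σ in (0:ℝ)..t, (σ + ε) ^ (-1 : ℝ) ≤ 1 / ε * t := by
  calc ∫ σ in (0:ℝ)..t, (σ + ε) ^ (-1 : ℝ) ≤ ∫ _ in (0:ℝ)..t, 1 / ε := by
        refine intervalIntegral.integral_mono_on ht (intervalIntegrable_add_rpow hε ht _)
          intervalIntegrable_const fun σ hσ => ?_
        rw [Real.rpow_neg_one, one_div]
        exact inv_anti₀ hε (by linarith [hσ.1])
    _ = 1 / ε * t := by simp [mul_comm]

lemma integral_add_rpow_le (hε : 0 < ε) (hε1 : ε ≤ 1) (ht : 0 ≤ t) (hβ : 0 ≤ β) :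
    ∫ σ in (0:ℝ)..t, (σ + ε) ^ β ≤ 2 ^ (β + 1) * (t ^ (β + 1) + 1) := by
  have h1 : ∫ σ in (0:ℝ)..t, (σ + ε) ^ β ≤ (t + 1) ^ (β + 1) := by
    calc ∫ σ in (0:ℝ)..t, (σ + ε) ^ β ≤ ∫ _ in (0:ℝ)..t, (t + 1) ^ β := by
          refine intervalIntegral.integral_mono_on ht (intervalIntegrable_add_rpow hε ht _)
            intervalIntegrable_const fun σ hσ => ?_
          exact Real.rpow_le_rpow (by linarith [hσ.1]) (by linarith [hσ.2]) hβ
      _ = t * (t + 1) ^ β := by simp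
      _ ≤ (t + 1) * (t + 1) ^ β := by gcongr; linarith
      _ = (t + 1) ^ (β + 1) := by rw [Real.rpow_add_one (by positivity)]; ring
  refine h1.trans ?_
  have h2 : 0 ≤ t ^ (β + 1) := by positivity
  rcases le_total t 1 with h | h
  · have h3 : (t + 1) ^ (β + 1) ≤ 2 ^ (β + 1) :=
      Real.rpow_le_rpow (by positivity) (by linarith) (by positivity)
    exact h3.trans (le_mul_of_one_le_right (by positivity) (by linarith))
  · have h3 : (t + 1) ^ (β + 1) ≤ (2 * t) ^ (β + 1) :=
      Real.rpow_le_rpow (by positivity) (by linarith) (by positivity)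
    rw [Real.mul_rpow (by positivity) ht] at h3
    exact h3.trans (mul_le_mul_of_nonneg_left (by linarith) (by positivity))

lemma integral_source_eq (hε : 0 < ε) (ht : 0 ≤ t) (a b : ℝ) :
    ∫ σ in (0:ℝ)..t, (a * (σ + ε) ^ (-α) + b * (σ + ε) ^ β) =
      a * (∫ σ in (0:ℝ)..t, (σ + ε) ^ (-α)) + b * ∫ σ in (0:ℝ)..t, (σ + ε) ^ β := by
  rw [intervalIntegral.integral_add ((intervalIntegrable_add_rpow hε ht _).const_mul a)
    ((intervalIntegrable_add_rpow hε ht _).const_mul b), intervalIntegral.integral_const_mul,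
    intervalIntegral.integral_const_mul]

end Primitive

section Source

variable {A G : ℝ → ℝ} {s p α β ε C₀ : ℝ} {N : ℕ} {Ω : Set (Euc N)}

lemma exists_lintegral_singular_le (hG : IsNFunction G)
    (hA : ConjGrowth A p) (hp : 1 < p) (hΩ : volume Ω ≠ ⊤)
    (hEmb : ∀ w : Euc N → ℝ, MemW0 G s Ω w → luxNorm A Ω w ≤ C₀ * W0norm G s N w)
    (hC₀ : 0 < C₀) (hα : 0 < α) (hε : 0 < ε) {f : Euc N → ℝ}
    (hA1 : 1 < α → IntegrableOn f Ω)
    (hA2 : α = 1 → MemOrlicz (conjFun A) Ω f)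
    (hA3 : α < 1 → MemOrlicz (conjFun fun t => A (t ^ (1 / (1 - α)))) Ω f) :
    ∃ C : ℝ, 0 ≤ C ∧ ∀ w : Euc N → ℝ, MemW0 G s Ω w → 0 < W0norm G s N w →
      ∫⁻ x in Ω, ENNReal.ofReal (|f x| * ∫ σ in (0:ℝ)..|w x|, (σ + ε) ^ (-α)) ≤
        ENNReal.ofReal (C * (W0norm G s N w ^ (1 - α) + 1 + W0norm G s N w)) := by
  have key : ∀ {c C q : ℝ} {w : Euc N → ℝ}, 0 ≤ c →
      (∀ t : ℝ, 0 ≤ t → ∫ σ in (0:ℝ)..t, (σ + ε) ^ (-α) ≤ c * t ^ q) →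
      ∫⁻ x in Ω, ENNReal.ofReal (|f x| * |w x| ^ q) ≤ ENNReal.ofReal C →
      ∫⁻ x in Ω, ENNReal.ofReal (|f x| * ∫ σ in (0:ℝ)..|w x|, (σ + ε) ^ (-α)) ≤
        ENNReal.ofReal (c * C) := by
    intro c C q w hc hle hC
    calc ∫⁻ x in Ω, ENNReal.ofReal (|f x| * ∫ σ in (0:ℝ)..|w x|, (σ + ε) ^ (-α))
        ≤ ∫⁻ x in Ω, ENNReal.ofReal c * ENNReal.ofReal (|f x| * |w x| ^ q) := by
          refine lintegral_mono fun x => ?_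
          rw [← ENNReal.ofReal_mul hc]
          refine ENNReal.ofReal_le_ofReal ?_
          have := mul_le_mul_of_nonneg_left (hle |w x| (abs_nonneg _)) (abs_nonneg (f x))
          linarith
      _ ≤ ENNReal.ofReal (c * C) := by
          rw [lintegral_const_mul' _ _ ENNReal.ofReal_ne_top, ENNReal.ofReal_mul hc]
          gcongr
  rcases lt_trichotomy α 1 with h | h | h
  · obtain ⟨C, hC0, hC⟩ := exists_lintegral_abs_mul_rpow_le hG hA hΩ hEmb hC₀
      (by linarith : 0 < 1 - α) (by linarith) (hA3 h)
    have hc : 0 ≤ 1 / (1 - α) := by have : 0 < 1 - α := by linarith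
                                    positivity
    refine ⟨1 / (1 - α) * C, by positivity, fun w hw hn => ?_⟩
    refine (key hc (fun t ht => integral_add_rpow_neg_le_of_lt_one hε ht h hα)
      (hC w hw hn)).trans (ENNReal.ofReal_le_ofReal ?_)
    rw [← mul_assoc]
    exact mul_le_mul_of_nonneg_left (by linarith) (by positivity)
  · subst h
    obtain ⟨C, hC0, hC⟩ := exists_lintegral_abs_mul_rpow_le hG hA hΩ hEmb hC₀
      one_pos hp (h := f) (by simpa using hA2 rfl)
    refine ⟨1 / ε * C, by positivity, fun w hw hn => ?_⟩
    refine (key (c := 1 / ε) (q := 1) (by positivity) (fun t ht => ?_) (hC w hw hn)).trans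
      (ENNReal.ofReal_le_ofReal ?_)
    · rw [Real.rpow_one]
      exact integral_add_rpow_neg_one_le hε ht
    · rw [← mul_assoc, Real.rpow_one]
      have h1 : 0 ≤ W0norm G s N w ^ ((1 : ℝ) - 1) := by positivity
      exact mul_le_mul_of_nonneg_left (by linarith) (by positivity)
  · have hfin : ∫⁻ x in Ω, ENNReal.ofReal |f x| ≠ ⊤ := by
      have := (hA1 h).abs.lintegral_lt_top
      exact this.ne
    have hc : 0 ≤ ε ^ (1 - α) / (α - 1) := div_nonneg (by positivity) (by linarith)
    refine ⟨ε ^ (1 - α) / (α - 1) * (∫⁻ x in Ω, ENNReal.ofReal |f x|).toReal,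
      mul_nonneg hc ENNReal.toReal_nonneg, fun w hw hn => ?_⟩
    refine (key (C := (∫⁻ x in Ω, ENNReal.ofReal |f x|).toReal) (q := 0) hc
      (fun t ht => ?_) ?_).trans (ENNReal.ofReal_le_ofReal ?_)
    · rw [Real.rpow_zero, mul_one]
      exact integral_add_rpow_neg_le_of_one_lt hε ht h
    · simp only [Real.rpow_zero, mul_one]
      rw [ENNReal.ofReal_toReal hfin]
    · refine le_mul_of_one_le_right (mul_nonneg hc ENNReal.toReal_nonneg) ?_
      have h1 : 0 ≤ W0norm G s N w ^ (1 - α) := by positivity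
      linarith

lemma exists_lintegral_power_le (hG : IsNFunction G)
    (hA : ConjGrowth A p) (hΩ : volume Ω ≠ ⊤)
    (hEmb : ∀ w : Euc N → ℝ, MemW0 G s Ω w → luxNorm A Ω w ≤ C₀ * W0norm G s N w)
    (hC₀ : 0 < C₀) (hβ0 : 0 < β) (hβ : β + 1 < p) (hε : 0 < ε) (hε1 : ε ≤ 1) {k : Euc N → ℝ}
    (hk : MemOrlicz (conjFun fun t => A (t ^ (1 / (β + 1)))) Ω k) :
    ∃ C : ℝ, 0 ≤ C ∧ ∀ w : Euc N → ℝ, MemW0 G s Ω w → 0 < W0norm G s N w →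
      ∫⁻ x in Ω, ENNReal.ofReal (|k x| * ∫ σ in (0:ℝ)..|w x|, (σ + ε) ^ β) ≤
        ENNReal.ofReal (C * (W0norm G s N w ^ (1 + β) + 1)) := by
  have hq : 0 < β + 1 := by linarith
  obtain ⟨C, hC0, hC⟩ := exists_lintegral_abs_mul_rpow_le hG hA hΩ hEmb hC₀ hq hβ hk
  obtain ⟨D, hD0, hD⟩ := exists_lintegral_abs_le hA hΩ hq hβ hk
  refine ⟨2 ^ (β + 1) * (C + D), by positivity, fun w hw hn => ?_⟩
  calc ∫⁻ x in Ω, ENNReal.ofReal (|k x| * ∫ σ in (0:ℝ)..|w x|, (σ + ε) ^ β)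
      ≤ ∫⁻ x in Ω, ENNReal.ofReal (2 ^ (β + 1)) *
          (ENNReal.ofReal (|k x| * |w x| ^ (β + 1)) + ENNReal.ofReal |k x|) := by
        refine lintegral_mono fun x => ?_
        rw [← ENNReal.ofReal_add (by positivity) (by positivity),
          ← ENNReal.ofReal_mul (by positivity)]
        refine ENNReal.ofReal_le_ofReal ?_
        have := mul_le_mul_of_nonneg_left
          (integral_add_rpow_le hε hε1 (abs_nonneg (w x)) hβ0.le) (abs_nonneg (k x))
        linarith
    _ = ENNReal.ofReal (2 ^ (β + 1)) *
          ((∫⁻ x in Ω, ENNReal.ofReal (|k x| * |w x| ^ (β + 1))) +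
            ∫⁻ x in Ω, ENNReal.ofReal |k x|) := by
        rw [lintegral_const_mul' _ _ ENNReal.ofReal_ne_top,
          lintegral_add_right _ hk.1.abs.ennreal_ofReal]
    _ ≤ ENNReal.ofReal (2 ^ (β + 1)) *
          (ENNReal.ofReal (C * W0norm G s N w ^ (β + 1)) + ENNReal.ofReal D) := by
        gcongr
        exact hC w hw hn
    _ = ENNReal.ofReal (2 ^ (β + 1) * (C * W0norm G s N w ^ (β + 1) + D)) := by
        rw [← ENNReal.ofReal_add (by positivity) hD0, ← ENNReal.ofReal_mul (by positivity)]
    _ ≤ _ := by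
        refine ENNReal.ofReal_le_ofReal ?_
        rw [mul_assoc, add_comm 1 β]
        refine mul_le_mul_of_nonneg_left ?_ (by positivity)
        have : 0 ≤ D * W0norm G s N w ^ (β + 1) := by positivity
        linarith

lemma exists_integral_source_le (hG : IsNFunction G)
    (hA : ConjGrowth A p) (hp : 1 < p) (hΩ : volume Ω ≠ ⊤)
    (hEmb : ∀ w : Euc N → ℝ, MemW0 G s Ω w → luxNorm A Ω w ≤ C₀ * W0norm G s N w)
    (hC₀ : 0 < C₀) (hα : 0 < α) (hβ0 : 0 < β) (hβ : β + 1 < p) (hε : 0 < ε) (hε1 : ε ≤ 1)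
    {f k : Euc N → ℝ}
    (hk : MemOrlicz (conjFun fun t => A (t ^ (1 / (β + 1)))) Ω k)
    (hA1 : 1 < α → IntegrableOn f Ω)
    (hA2 : α = 1 → MemOrlicz (conjFun A) Ω f)
    (hA3 : α < 1 → MemOrlicz (conjFun fun t => A (t ^ (1 / (1 - α)))) Ω f) :
    ∃ C : ℝ, 0 < C ∧ ∀ w : Euc N → ℝ, MemW0 G s Ω w →
      (∀ᵐ x ∂(volume : Measure (Euc N)), 0 ≤ w x) → 0 < W0norm G s N w →
      ∫ x in Ω, ∫ σ in (0:ℝ)..(w x), (f x * (σ + ε) ^ (-α) + k x * (σ + ε) ^ β) ≤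
        C * (W0norm G s N w ^ (1 - α) + W0norm G s N w ^ (1 + β) + 1 + W0norm G s N w) := by
  obtain ⟨C, hC0, hC⟩ := exists_lintegral_singular_le hG hA hp hΩ hEmb hC₀ hα hε hA1 hA2 hA3
  obtain ⟨D, hD0, hD⟩ := exists_lintegral_power_le hG hA hΩ hEmb hC₀ hβ0 hβ hε hε1 hk
  refine ⟨C + D + 1, by positivity, fun w hw hw0 hn => ?_⟩
  set n := W0norm G s N w
  have ha : 0 ≤ n ^ (1 - α) := by positivity
  have hb : 0 ≤ n ^ (1 + β) := by positivity
  have hS : 0 ≤ (C + D + 1) * (n ^ (1 - α) + n ^ (1 + β) + 1 + n) := by positivity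
  by_cases hint : Integrable (fun x => ∫ σ in (0:ℝ)..(w x),
      (f x * (σ + ε) ^ (-α) + k x * (σ + ε) ^ β)) (volume.restrict Ω)
  swap
  · rw [integral_undef hint]
    exact hS
  rw [integral_eq_lintegral_pos_part_sub_lintegral_neg_part hint]
  refine (sub_le_self _ ENNReal.toReal_nonneg).trans (ENNReal.toReal_le_of_le_ofReal hS ?_)
  have hkm : Measurable fun x => ENNReal.ofReal (|k x| * ∫ σ in (0:ℝ)..|w x|, (σ + ε) ^ β) := by
    have hq : β ≠ -1 := fun h => by linarith
    simp only [fun x => integral_add_rpow (t := |w x|) hε (abs_nonneg _) hq]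
    exact (hk.1.abs.mul ((((hw.1.abs.add_const ε).pow_const _).sub_const _).div_const
      _)).ennreal_ofReal
  calc ∫⁻ x in Ω, ENNReal.ofReal (∫ σ in (0:ℝ)..(w x),
        (f x * (σ + ε) ^ (-α) + k x * (σ + ε) ^ β))
      ≤ ∫⁻ x in Ω, (ENNReal.ofReal (|f x| * ∫ σ in (0:ℝ)..|w x|, (σ + ε) ^ (-α)) +
          ENNReal.ofReal (|k x| * ∫ σ in (0:ℝ)..|w x|, (σ + ε) ^ β)) := by
        refine lintegral_mono_ae ?_
        filter_upwards [ae_restrict_of_ae hw0] with x hx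
        have h1 := integral_add_rpow_nonneg hε hx (-α)
        have h2 := integral_add_rpow_nonneg hε hx β
        rw [abs_of_nonneg hx, ← ENNReal.ofReal_add (by positivity) (by positivity),
          integral_source_eq hε hx]
        refine ENNReal.ofReal_le_ofReal ?_
        gcongr <;> exact le_abs_self _
    _ ≤ ENNReal.ofReal (C * (n ^ (1 - α) + 1 + n)) + ENNReal.ofReal (D * (n ^ (1 + β) + 1)) := by
        rw [lintegral_add_right _ hkm]
        exact add_le_add (hC w hw hn) (hD w hw hn)
    _ ≤ _ := by
        rw [← ENNReal.ofReal_add (by positivity) (by positivity)]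
        refine ENNReal.ofReal_le_ofReal ?_
        have h1 : 0 ≤ C * n ^ (1 + β) := by positivity
        have h2 : 0 ≤ D * n ^ (1 - α) := by positivity
        have h3 : 0 ≤ D * n := by positivity
        nlinarith

end Source

lemma exists_le_rpow_sub_of_lt {a b p C : ℝ} (ha : 0 ≤ a) (hb : 0 < b) (hbp : b + 1 < p)
    (hC : 0 ≤ C) (M : ℝ) :
    ∃ R : ℝ, 1 ≤ R ∧ ∀ n : ℝ, R ≤ n →
      M ≤ n ^ p - C * (n ^ (1 - a) + n ^ (1 + b) + 1 + n) := by
  obtain ⟨R, hR⟩ := eventually_atTop.1 ((tendsto_rpow_atTop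
    (by linarith : 0 < p - (1 + b))).eventually_ge_atTop (4 * C + 1))
  refine ⟨max 1 (max R M), le_max_left _ _, fun n hn => ?_⟩
  have hn1 : 1 ≤ n := (le_max_left _ _).trans hn
  have hnR : R ≤ n := ((le_max_left _ _).trans (le_max_right _ _)).trans hn
  have hnM : M ≤ n := ((le_max_right _ _).trans (le_max_right _ _)).trans hn
  have h1 : n ^ (1 - a) ≤ n ^ (1 + b) := Real.rpow_le_rpow_of_exponent_le hn1 (by linarith)
  have h2 : n ≤ n ^ (1 + b) := by
    simpa using Real.rpow_le_rpow_of_exponent_le hn1 (by linarith : (1 : ℝ) ≤ 1 + b)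
  have h3 : n ^ p = n ^ (p - (1 + b)) * n ^ (1 + b) := by
    rw [← Real.rpow_add (by linarith)]; simp
  have h4 : (4 * C + 1) * n ^ (1 + b) ≤ n ^ p := by
    rw [h3]
    exact mul_le_mul_of_nonneg_right (hR n hnR) (by linarith)
  have h5 := mul_le_mul_of_nonneg_left
    (by linarith : n ^ (1 - a) + n ^ (1 + b) + 1 + n ≤ 4 * n ^ (1 + b)) hC
  linarith

/-- coercivity of `𝒥_ε`: under (H1)–(H4) on `G` (so that the embedding
`‖w‖_{L^{G_*}(Ω)} ≤ C₀ ‖w‖_{W^{s,G}_0(Ω)}` holds), `0 < β < p⁻ − 1`, `α > 0`, `k` in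
`L^{K̄}(Ω)` positive and `f` nonnegative satisfying (A1)–(A3), the functional `𝒥_ε` is
coercive on nonnegative functions of `W^{s,G}_0(Ω)`; in particular
`𝒥_ε(w) ≥ ‖w‖^{p⁻} (1 − C(‖w‖^{1−α−p⁻} + ‖w‖^{1+β−p⁻} + ‖w‖^{−p⁻} + ‖w‖^{1−p⁻}))`
for `‖w‖ = ‖w‖_{W^{s,G}_0(Ω)}` large enough. -/
theorem Jeps_coercive
    {N : ℕ} (hN : 0 < N)
    (Ω : Set (Euc N)) (hΩopen : IsOpen Ω) (hΩbd : Bornology.IsBounded Ω)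
    (hΩconn : IsConnected Ω)
    (s : ℝ) (hs0 : 0 < s) (hs1 : s < 1)
    (G g g' Ginv Gstar : ℝ → ℝ)
    (hG : IsNFunction G)
    (hGg : ∀ t : ℝ, 0 < t → HasDerivAt G (g t) t)
    (hg0 : g 0 = 0)
    (hgg' : ∀ t : ℝ, 0 < t → HasDerivAt g (g' t) t)
    (hg'cont : ContinuousOn g' (Set.Ioi 0))
    (hg'mono : MonotoneOn g' (Set.Ioi 0))
    (pm pp : ℝ) (hpm : 1 < pm - 1) (hpmpp : pm ≤ pp)
    (hH4 : ∀ t : ℝ, 0 < t → pm - 1 ≤ t * g' t / g t ∧ t * g' t / g t ≤ pp - 1)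
    (hGinv : ∀ t : ℝ, 0 ≤ t → 0 ≤ Ginv t ∧ G (Ginv t) = t ∧ Ginv (G t) = t)
    (hH3fin : IntegrableOn (fun τ => Ginv τ / τ ^ (((N : ℝ) + s) / N)) (Set.Ioc 0 1))
    (hH3inf : ¬ IntegrableOn (fun τ => Ginv τ / τ ^ (((N : ℝ) + s) / N)) (Set.Ioi 1))
    (hGstar : ∀ t : ℝ, 0 ≤ t →
      Gstar (∫ τ in Set.Ioc (0:ℝ) t, Ginv τ / τ ^ (((N : ℝ) + s) / N)) = t)
    -- the continuous embedding `W^{s,G}_0(Ω) ↪ L^{G_*}(Ω)`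
    (hEmb : ∃ C₀ : ℝ, 0 < C₀ ∧ ∀ w : Euc N → ℝ, MemW0 G s Ω w →
      luxNorm Gstar Ω w ≤ C₀ * W0norm G s N w)
    (α β : ℝ) (hα : 0 < α) (hβ0 : 0 < β) (hβ : β < pm - 1)
    (f k : Euc N → ℝ) (hfmeas : Measurable f)
    (hk : MemOrlicz (conjFun fun t => Gstar (t ^ (1 / (β + 1)))) Ω k)
    (hkpos : ∀ᵐ x ∂(volume.restrict Ω), 0 < k x)
    (hf0 : ∀ᵐ x ∂(volume.restrict Ω), 0 ≤ f x)
    (hA1 : 1 < α → IntegrableOn f Ω)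
    (hA2 : α = 1 → MemOrlicz (conjFun Gstar) Ω f)
    (hA3 : α < 1 → MemOrlicz (conjFun fun t => Gstar (t ^ (1 / (1 - α)))) Ω f)
    (ε : ℝ) (hε0 : 0 < ε) (hε1 : ε < 1) :
    (∀ M : ℝ, ∃ R : ℝ, ∀ w : Euc N → ℝ, MemW0 G s Ω w →
      (∀ᵐ x ∂(volume : Measure (Euc N)), 0 ≤ w x) →
      R ≤ W0norm G s N w → M ≤ Jeps G s N Ω f k α β ε w) ∧
    (∃ C : ℝ, 0 < C ∧ ∃ R : ℝ, 0 < R ∧ ∀ w : Euc N → ℝ, MemW0 G s Ω w →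
      (∀ᵐ x ∂(volume : Measure (Euc N)), 0 ≤ w x) → R ≤ W0norm G s N w →
      W0norm G s N w ^ pm *
          (1 - C * (W0norm G s N w ^ (1 - α - pm) + W0norm G s N w ^ (1 + β - pm)
            + W0norm G s N w ^ (-pm) + W0norm G s N w ^ (1 - pm)))
        ≤ Jeps G s N Ω f k α β ε w) := by
  obtain ⟨C₀, hC₀, hEmb⟩ := hEmb
  have hlow : ∀ t : ℝ, 0 < t → pm * G t ≤ t * g t := fun t ht =>
    le_mul_deriv hG hGg hgg' hpm (fun t ht => (hH4 t ht).1) ht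
  have hupp : ∀ t : ℝ, 0 < t → t * g t ≤ pp * G t := fun t ht =>
    mul_deriv_le hG hGg hgg' hpm (by linarith) (fun t ht => (hH4 t ht).1)
      (fun t ht => (hH4 t ht).2) ht
  have hr : 1 ≤ ((N : ℝ) + s) / N := by
    have : (0 : ℝ) < N := Nat.cast_pos.2 hN
    rw [le_div_iff₀ this]
    linarith
  have hA : ConjGrowth Gstar pm :=
    conjGrowth_of_conjInv hG hGg (by linarith) hlow hGinv hr hH3fin hH3inf hGstar
  obtain ⟨C, hC0, hC⟩ := exists_integral_source_le hG hA (by linarith)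
    hΩbd.measure_lt_top.ne hEmb hC₀ hα hβ0 (by linarith) hε0 hε1.le hk hA1 hA2 hA3
  have hJ : ∀ w : Euc N → ℝ, MemW0 G s Ω w → (∀ᵐ x ∂(volume : Measure (Euc N)), 0 ≤ w x) →
      1 < W0norm G s N w →
      W0norm G s N w ^ pm - C * (W0norm G s N w ^ (1 - α) + W0norm G s N w ^ (1 + β) + 1 +
        W0norm G s N w) ≤ Jeps G s N Ω f k α β ε w := fun w hw hw0 hn =>
    sub_le_sub (W0norm_rpow_le_fracModular hG hGg (by linarith) hlow hn
      (fracModular_lt_top hG hGg hupp hw).ne) (hC w hw hw0 (one_pos.trans hn))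
  constructor
  · intro M
    obtain ⟨R, hR1, hR⟩ := exists_le_rpow_sub_of_lt (p := pm) hα.le hβ0 (by linarith) hC0.le M
    refine ⟨R + 1, fun w hw hw0 hn => ?_⟩
    exact (hR _ (by linarith)).trans (hJ w hw hw0 (by linarith))
  · refine ⟨C, hC0, 2, two_pos, fun w hw hw0 hn => ?_⟩
    refine le_trans (le_of_eq ?_) (hJ w hw hw0 (by linarith))
    have hn0 : 0 < W0norm G s N w := by linarith
    have hpow : W0norm G s N w ^ pm ≠ 0 := (Real.rpow_pos_of_pos hn0 pm).ne'
    rw [Real.rpow_sub hn0 (1 - α), Real.rpow_sub hn0 (1 + β), Real.rpow_neg hn0.le,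
      Real.rpow_sub hn0 1 pm, Real.rpow_one]
    field_simp
end
end
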